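/- arXiv:2311.00543 — 2 statements merged into one kernel-verified Lean document; each statement's English description precedes it below -/
import Mathlib

section
/- Counting estimate with fixed total frequency (the supremum counting lemma of Section 3.2): Let k ≥ 3 be an integer and 1 < α ≤ 2. For every choice of signs ε_sum, ε_1, …, ε_k ∈ {−1, +1} there exists a constant C = C(α, k) > 0 such that for all dyadic numbers N_1, …, N_k ≥ 1, every ζ ∈ ℝ, and every n ∈ ℤ³, the cardinality of the set { (n_1, …, n_k) ∈ (ℤ³)^k : |n_j| ∼ N_j for each j, n = Σ_{j=1}^k n_j, and |κ(n_1, …, n_k) − ζ| ≤ 1 } is at most C · (max{N_1, …, N_k})^{−3} · (max_(3){N_1, …, N_k})^{−1} · Π_{j=1}^k N_j³. -/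
noncomputable section

open scoped BigOperators

/-- Japanese bracket of a real number: `⟨x⟩ = (1 + x²)^{1/2}`. -/
def rjb (x : ℝ) : ℝ := Real.sqrt (1 + x ^ 2)

/-- Euclidean norm of a lattice point in `ℤ³`. -/
def znorm (n : Fin 3 → ℤ) : ℝ := Real.sqrt (∑ i, ((n i : ℝ)) ^ 2)

/-- Japanese bracket `⟨n⟩ = (1 + |n|²)^{1/2}` of a lattice point in `ℤ³`. -/
def jb (n : Fin 3 → ℤ) : ℝ := Real.sqrt (1 + ∑ i, ((n i : ℝ)) ^ 2)

/-- The modified bracket `⟪n⟫ = (⟨n⟩^{2α} − 1/4)^{1/2}`. -/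
def jbb (α : ℝ) (n : Fin 3 → ℤ) : ℝ := Real.sqrt (jb n ^ (2 * α) - 1 / 4)

/-- Dyadic numbers `2^j`, `j ≥ 0`. -/
def IsDyadic (N : ℝ) : Prop := ∃ j : ℕ, N = 2 ^ j

/-- `|n| ∼ N` for a dyadic number `N`: `N/2 < |n| ≤ N` if `N ≥ 2`, and `|n| ≤ 1` if `N = 1`. -/
def SimFreq (N : ℝ) (n : Fin 3 → ℤ) : Prop :=
  (2 ≤ N ∧ N / 2 < znorm n ∧ znorm n ≤ N) ∨ (N < 2 ∧ znorm n ≤ 1)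

/-- `x` is a sign `±1`. -/
def IsSign (x : ℝ) : Prop := x = 1 ∨ x = -1

open Classical in
/-- Real-valued indicator of a proposition. -/
def ind (p : Prop) : ℝ := if p then 1 else 0

/-- The phase `κ(n₁,…,n_k) = ε_sum ⟪n₁+⋯+n_k⟫ + Σ_j ε_j ⟪n_j⟫`. -/
def phase (α : ℝ) {k : ℕ} (εsum : ℝ) (ε : Fin k → ℝ) (n : Fin k → Fin 3 → ℤ) : ℝ :=
  εsum * jbb α (∑ j, n j) + ∑ j, ε j * jbb α (n j)

/-- The third largest entry of a finite tuple of reals (with multiplicity). -/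
def thirdMax {k : ℕ} (Nv : Fin k → ℝ) : ℝ :=
  sSup {x : ℝ | ∃ i j l : Fin k, i ≠ j ∧ i ≠ l ∧ j ≠ l ∧
    x = min (Nv i) (min (Nv j) (Nv l))}

/-- The radial profile of the gradient of `x ↦ ((1 + ‖x‖²)^α - 1/4)^{1/2}`, as a function of
`u = 1 + ‖x‖²`. -/
def gradProfile (α u : ℝ) : ℝ := α * u ^ (α - 1) / Real.sqrt (u ^ α - 1 / 4)

/-- The logarithmic derivative of `gradProfile`. -/
def gradProfileLogDeriv (α u : ℝ) : ℝ := (α - 1) / u - α * u ^ (α - 1) / (2 * (u ^ α - 1 / 4))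

section Profile

variable {α u : ℝ}

lemma one_le_rpow_base (hα : 1 < α) (hu : 1 ≤ u) : 1 ≤ u ^ α :=
  Real.one_le_rpow hu (by linarith)

lemma hasDerivAt_sqrt_rpow (hα : 1 < α) (hu : 1 ≤ u) :
    HasDerivAt (fun v : ℝ => Real.sqrt (v ^ α - 1 / 4)) (gradProfile α u / 2) u := by
  have h1 := one_le_rpow_base hα hu
  have h := ((Real.hasDerivAt_rpow_const (p := α) (Or.inl (by linarith : u ≠ 0))).sub_const
    (1 / 4 : ℝ)).sqrt (by linarith)
  convert h using 1
  unfold gradProfile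
  field_simp

lemma hasDerivAt_gradProfile (hα : 1 < α) (hu : 1 ≤ u) :
    HasDerivAt (gradProfile α) (gradProfile α u * gradProfileLogDeriv α u) u := by
  have h1 := one_le_rpow_base hα hu
  have hu0 : 0 < u := by linarith
  have hpos : 0 < u ^ α - 1 / 4 := by linarith
  have hs : 0 < Real.sqrt (u ^ α - 1 / 4) := Real.sqrt_pos.2 hpos
  have hnum := (Real.hasDerivAt_rpow_const (p := α - 1) (Or.inl hu0.ne')).const_mul α
  have h := hnum.div (hasDerivAt_sqrt_rpow hα hu) hs.ne'
  refine h.congr_deriv ?_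
  have e1 : u ^ (α - 1 - 1) = u ^ (α - 1) / u := Real.rpow_sub_one hu0.ne' _
  have e2 := Real.sq_sqrt hpos.le
  unfold gradProfile gradProfileLogDeriv
  rw [e1]
  generalize Real.sqrt (u ^ α - 1 / 4) = s at *
  rw [← e2]
  generalize u ^ (α - 1) = p at *
  field_simp

lemma inv_sqrt_le_gradProfile (hα : 1 < α) (hu : 1 ≤ u) :
    (Real.sqrt u)⁻¹ ≤ gradProfile α u := by
  have h1 := one_le_rpow_base hα hu
  have hu0 : 0 < u := by linarith
  have hs : 0 < Real.sqrt (u ^ α - 1 / 4) := Real.sqrt_pos.2 (by linarith)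
  unfold gradProfile
  rw [le_div_iff₀ hs, inv_mul_le_iff₀ (Real.sqrt_pos.2 hu0)]
  have hle : Real.sqrt (u ^ α - 1 / 4) ≤ Real.sqrt (u ^ α) := Real.sqrt_le_sqrt (by linarith)
  refine hle.trans ?_
  have hp : 0 < u ^ (α - 1) := Real.rpow_pos_of_pos hu0 _
  have e : Real.sqrt (u ^ α) ≤ Real.sqrt u * u ^ (α - 1) := by
    rw [Real.sqrt_eq_rpow, Real.sqrt_eq_rpow, ← Real.rpow_mul hu0.le, ← Real.rpow_add hu0]
    exact Real.rpow_le_rpow_of_exponent_le hu (by linarith)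
  refine e.trans ?_
  gcongr
  nlinarith

lemma gradProfile_pos (hα : 1 < α) (hu : 1 ≤ u) : 0 < gradProfile α u :=
  (inv_pos.2 (Real.sqrt_pos.2 (by linarith))).trans_le (inv_sqrt_le_gradProfile hα hu)

lemma abs_gradProfileLogDeriv_le (hα : 1 < α) (hα₂ : α ≤ 2) (hu : 1 ≤ u) :
    2 * |gradProfileLogDeriv α u| * (u - 1) ≤ max (2 - α) (1 / 2) := by
  have h1 := one_le_rpow_base hα hu
  have hu0 : 0 < u := by linarith
  have e1 : u ^ (α - 1) = u ^ α / u := Real.rpow_sub_one hu0.ne' _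
  have hP : u ≤ u ^ α := by
    simpa using Real.rpow_le_rpow_of_exponent_le hu hα.le
  have hL : gradProfileLogDeriv α u
      = -((2 - α + α / 4 / (u ^ α - 1 / 4)) / (2 * u)) := by
    unfold gradProfileLogDeriv
    rw [e1]
    generalize u ^ α = P at *
    have : P - 1 / 4 ≠ 0 := by linarith
    have : P * 4 - 1 ≠ 0 := by linarith
    field_simp
    ring
  have hq : 0 < u ^ α - 1 / 4 := by linarith
  have hnn : 0 ≤ (2 - α + α / 4 / (u ^ α - 1 / 4)) / (2 * u) := by
    have : 0 ≤ 2 - α := by linarith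
    positivity
  rw [hL, abs_neg, abs_of_nonneg hnn]
  have hdiv : α / 4 / (u ^ α - 1 / 4) ≤ α / 4 / (u - 1 / 4) := by
    gcongr
    linarith
  have hy : α / 4 / (u - 1 / 4) * (u - 1) ≤ α / 4 := by
    rw [div_mul_eq_mul_div, div_le_iff₀ (by linarith)]
    nlinarith
  have key : (2 - α + α / 4 / (u ^ α - 1 / 4)) * (u - 1) ≤ max (2 - α) (1 / 2) * u := by
    have hm1 := le_max_left (2 - α) (1 / 2 : ℝ)
    have hm2 := le_max_right (2 - α) (1 / 2 : ℝ)
    have : α / 4 / (u ^ α - 1 / 4) * (u - 1) ≤ α / 4 :=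
      (mul_le_mul_of_nonneg_right hdiv (by linarith)).trans hy
    nlinarith
  calc _ = (2 - α + α / 4 / (u ^ α - 1 / 4)) * (u - 1) / u := by field_simp
    _ ≤ _ := by rwa [div_le_iff₀ hu0]

end Profile

section Dispersion

open scoped RealInnerProductSpace

variable {E : Type*} [NormedAddCommGroup E] [InnerProductSpace ℝ E] {α η M : ℝ}

/-- The dispersion relation `x ↦ ((1 + ‖x‖²)^α - 1/4)^{1/2}`. -/
def dispersion (α : ℝ) (x : E) : ℝ := Real.sqrt ((1 + ‖x‖ ^ 2) ^ α - 1 / 4)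

/-- The derivative of the dispersion relation at `x` in direction `w`. -/
def dispersionDeriv (α : ℝ) (x w : E) : ℝ := gradProfile α (1 + ‖x‖ ^ 2) * ⟪x, w⟫

lemma dispersionDeriv_neg_left (x w : E) :
    dispersionDeriv α (-x) w = -dispersionDeriv α x w := by
  simp [dispersionDeriv]

lemma dispersionDeriv_neg_right (x w : E) :
    dispersionDeriv α x (-w) = -dispersionDeriv α x w := by
  simp [dispersionDeriv]

lemma hasDerivAt_one_add_norm_sq (x w : E) (s : ℝ) :
    HasDerivAt (fun s : ℝ => 1 + ‖x + s • w‖ ^ 2) (2 * ⟪x + s • w, w⟫) s := by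
  have h : HasDerivAt (fun s : ℝ => x + s • w) w s := by
    simpa using ((hasDerivAt_id s).smul_const w).const_add x
  exact h.norm_sq.const_add 1

lemma hasDerivAt_dispersion (hα : 1 < α) (x w : E) (s : ℝ) :
    HasDerivAt (fun s : ℝ => dispersion α (x + s • w)) (dispersionDeriv α (x + s • w) w) s := by
  have hu : 1 ≤ 1 + ‖x + s • w‖ ^ 2 := by nlinarith [sq_nonneg ‖x + s • w‖]
  refine ((hasDerivAt_sqrt_rpow hα hu).comp s (hasDerivAt_one_add_norm_sq x w s)).congr_deriv ?_
  unfold dispersionDeriv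
  ring

lemma hasDerivAt_dispersionDeriv (hα : 1 < α) (y v w : E) (s : ℝ) :
    HasDerivAt (fun s : ℝ => dispersionDeriv α (y + s • v) w)
      (gradProfile α (1 + ‖y + s • v‖ ^ 2) * (⟪v, w⟫ +
        gradProfileLogDeriv α (1 + ‖y + s • v‖ ^ 2) * (2 * ⟪y + s • v, v⟫ * ⟪y + s • v, w⟫))) s := by
  have hu : 1 ≤ 1 + ‖y + s • v‖ ^ 2 := by nlinarith [sq_nonneg ‖y + s • v‖]
  have h1 := (hasDerivAt_gradProfile hα hu).comp s (hasDerivAt_one_add_norm_sq y v s)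
  have h2 : HasDerivAt (fun s : ℝ => ⟪y + s • v, w⟫) ⟪v, w⟫ s := by
    have h : HasDerivAt (fun s : ℝ => y + s • v) v s := by
      simpa using ((hasDerivAt_id s).smul_const v).const_add y
    simpa using h.inner ℝ (hasDerivAt_const s w)
  refine (h1.mul h2).congr_deriv ?_
  simp only [Function.comp]
  ring

lemma norm_add_smul_le {y v : E} {s t : ℝ} (h0 : ‖y‖ ≤ M) (h1 : ‖y + t • v‖ ≤ M)
    (hs : 0 ≤ s) (hst : s ≤ t) : ‖y + s • v‖ ≤ M := by
  rcases (hs.trans hst).eq_or_lt with ht | ht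
  · have : s = 0 := by linarith
    simpa [this] using h0
  · have e : y + s • v = (1 - s / t) • y + (s / t) • (y + t • v) := by
      rw [smul_add, smul_smul, div_mul_cancel₀ _ ht.ne', sub_smul, one_smul]
      abel
    have hst1 : s / t ≤ 1 := (div_le_one ht).2 hst
    have hst0 : 0 ≤ s / t := by positivity
    calc ‖y + s • v‖ ≤ ‖(1 - s / t) • y‖ + ‖(s / t) • (y + t • v)‖ := by
          rw [e]; exact norm_add_le _ _
      _ = (1 - s / t) * ‖y‖ + s / t * ‖y + t • v‖ := by
          rw [norm_smul, norm_smul, Real.norm_of_nonneg (by linarith), Real.norm_of_nonneg hst0]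
      _ ≤ M := by nlinarith

/-- Quantitative strict monotonicity of the gradient of the dispersion relation, tested against
directions close to the difference of the two base points. -/
lemma dispersionDeriv_add_sub_ge (hα : 1 < α) (hα₂ : α ≤ 2)
    (hη : η ≤ 1 - max (2 - α) (1 / 2)) {y v w : E}
    (hcone : (1 - η) * (‖v‖ * ‖w‖) ≤ ⟪v, w⟫) (hy : ‖y‖ ≤ M) (hyv : ‖y + v‖ ≤ M) :
    (1 - η - max (2 - α) (1 / 2)) * (‖v‖ * ‖w‖) / Real.sqrt (1 + M ^ 2) ≤
      dispersionDeriv α (y + v) w - dispersionDeriv α y w := by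
  obtain ⟨c, hc, hc'⟩ := exists_hasDerivAt_eq_slope
    (fun s : ℝ => dispersionDeriv α (y + s • v) w) _ zero_lt_one
    (fun s _ => (hasDerivAt_dispersionDeriv hα y v w s).continuousAt.continuousWithinAt)
    (fun s _ => hasDerivAt_dispersionDeriv hα y v w s)
  simp only [one_smul, zero_smul, add_zero, sub_zero, div_one] at hc'
  rw [← hc']
  have hM : 0 ≤ M := (norm_nonneg _).trans hy
  have hx : ‖y + c • v‖ ≤ M :=
    norm_add_smul_le hy (by simpa using hyv) hc.1.le hc.2.le
  set x := y + c • v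
  have hu : 1 ≤ 1 + ‖x‖ ^ 2 := by nlinarith [sq_nonneg ‖x‖]
  have hψ : (Real.sqrt (1 + M ^ 2))⁻¹ ≤ gradProfile α (1 + ‖x‖ ^ 2) := by
    refine le_trans ?_ (inv_sqrt_le_gradProfile hα hu)
    gcongr
  have hL := abs_gradProfileLogDeriv_le hα hα₂ hu
  rw [add_sub_cancel_left] at hL
  have hcs : |gradProfileLogDeriv α (1 + ‖x‖ ^ 2) * (2 * ⟪x, v⟫ * ⟪x, w⟫)| ≤
      max (2 - α) (1 / 2) * (‖v‖ * ‖w‖) := by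
    rw [abs_mul, abs_mul, abs_mul, abs_two]
    calc _ ≤ |gradProfileLogDeriv α (1 + ‖x‖ ^ 2)| *
            (2 * (‖x‖ * ‖v‖) * (‖x‖ * ‖w‖)) := by
          gcongr
          · exact abs_real_inner_le_norm _ _
          · exact abs_real_inner_le_norm _ _
      _ = 2 * |gradProfileLogDeriv α (1 + ‖x‖ ^ 2)| * ‖x‖ ^ 2 * (‖v‖ * ‖w‖) := by ring
      _ ≤ _ := by gcongr
  have hmain : (1 - η - max (2 - α) (1 / 2)) * (‖v‖ * ‖w‖) ≤
      ⟪v, w⟫ + gradProfileLogDeriv α (1 + ‖x‖ ^ 2) * (2 * ⟪x, v⟫ * ⟪x, w⟫) := by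
    have := (abs_le.1 hcs).1
    linarith
  rw [div_eq_inv_mul]
  have hnn : 0 ≤ (1 - η - max (2 - α) (1 / 2)) * (‖v‖ * ‖w‖) :=
    mul_nonneg (by linarith) (by positivity)
  exact mul_le_mul hψ hmain hnn (gradProfile_pos hα hu).le

/-- Along a direction `w` close to `a - σ • (q - a)`, the pair phase
`⟨a⟩ + σ ⟨q - a⟩` grows at least linearly. -/
lemma pair_phase_growth (hα : 1 < α) (hα₂ : α ≤ 2) (hη₀ : 0 ≤ η)
    (hη : η ≤ 1 - max (2 - α) (1 / 2)) {σ : ℝ} (hσ : σ = 1 ∨ σ = -1) {a q w : E} {t : ℝ}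
    (ht : 0 < t)
    (hcone : (1 - η) * (‖a - σ • (q - a)‖ * ‖w‖) ≤ ⟪a - σ • (q - a), w⟫)
    (h1 : ‖a‖ ≤ M) (h2 : ‖a + t • w‖ ≤ M) (h3 : ‖q - a‖ ≤ M) (h4 : ‖q - (a + t • w)‖ ≤ M) :
    (1 - η - max (2 - α) (1 / 2)) * (‖a - σ • (q - a)‖ * ‖w‖) / Real.sqrt (1 + M ^ 2) * t ≤
      (dispersion α (a + t • w) + σ * dispersion α (q - (a + t • w))) -
        (dispersion α a + σ * dispersion α (q - a)) := by
  have hderiv : ∀ s : ℝ, HasDerivAt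
      (fun s : ℝ => dispersion α (a + s • w) + σ * dispersion α ((q - a) + s • (-w)))
      (dispersionDeriv α (a + s • w) w + σ * dispersionDeriv α ((q - a) + s • (-w)) (-w)) s :=
    fun s => (hasDerivAt_dispersion hα a w s).add
      ((hasDerivAt_dispersion hα (q - a) (-w) s).const_mul σ)
  have e : ∀ s : ℝ, (q - a) + s • (-w) = q - (a + s • w) := fun s => by
    rw [smul_neg]; abel
  obtain ⟨s, hs, hs'⟩ := exists_hasDerivAt_eq_slope _ _ ht
    (fun s _ => (hderiv s).continuousAt.continuousWithinAt) (fun s _ => hderiv s)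
  simp only [zero_smul, add_zero, sub_zero, e] at hs'
  rw [eq_div_iff ht.ne'] at hs'
  rw [← hs']
  refine mul_le_mul_of_nonneg_right ?_ ht.le
  have hx : ‖a + s • w‖ ≤ M := norm_add_smul_le h1 h2 hs.1.le hs.2.le
  have hy : ‖q - (a + s • w)‖ ≤ M := by
    rw [← e]
    exact norm_add_smul_le h3 (by rwa [e]) hs.1.le hs.2.le
  have hmax : max (2 - α) (1 / 2) ≤ 1 := max_le (by linarith) (by norm_num)
  have hmax0 : 1 / 2 ≤ max (2 - α) (1 / 2) := le_max_right _ _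
  set d := a - σ • (q - a) with hd
  have hσ0 : 0 ≤ 1 + σ := by rcases hσ with rfl | rfl <;> norm_num
  set y := σ • (q - (a + s • w)) with hydef
  set v := d + ((1 + σ) * s) • w with hvdef
  have hyv : y + v = a + s • w := by
    rw [hydef, hvdef, hd]
    module
  have hμ : 0 ≤ (1 + σ) * s := mul_nonneg hσ0 hs.1.le
  have hnonneg : 0 ≤ ⟪d, w⟫ := le_trans (by
    refine mul_nonneg (by linarith) (by positivity)) hcone
  have hvnorm : ‖v‖ ≤ ‖d‖ + (1 + σ) * s * ‖w‖ := by
    refine (norm_add_le _ _).trans ?_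
    rw [norm_smul, Real.norm_of_nonneg hμ]
  have hdv : ‖d‖ ≤ ‖v‖ := by
    refine abs_le_of_sq_le_sq' ?_ (norm_nonneg _) |>.2
    rw [hvdef, norm_add_sq_real, inner_smul_right]
    nlinarith [sq_nonneg ‖((1 + σ) * s) • w‖, mul_nonneg hμ hnonneg]
  have hconev : (1 - η) * (‖v‖ * ‖w‖) ≤ ⟪v, w⟫ := by
    rw [hvdef, inner_add_left, inner_smul_left, real_inner_self_eq_norm_sq, ← hvdef]
    simp only [conj_trivial]
    have h5 : (1 - η) * (‖v‖ * ‖w‖) ≤ (1 - η) * ((‖d‖ + (1 + σ) * s * ‖w‖) * ‖w‖) := by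
      have : 0 ≤ 1 - η := by linarith
      gcongr
    have h6 : 0 ≤ η * ((1 + σ) * s * ‖w‖ ^ 2) := by positivity
    nlinarith
  have hyM : ‖y‖ ≤ M := by
    rw [hydef, norm_smul]
    rcases hσ with h | h <;> simpa [h] using hy
  have hfin := dispersionDeriv_add_sub_ge hα hα₂ hη hconev hyM (by rwa [hyv])
  have hodd : dispersionDeriv α (a + s • w) w +
      σ * dispersionDeriv α (q - (a + s • w)) (-w) =
      dispersionDeriv α (y + v) w - dispersionDeriv α y w := by
    rw [hyv, dispersionDeriv_neg_right, hydef]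
    rcases hσ with h | h
    · simp [h, sub_eq_add_neg]
    · rw [h, neg_one_smul, dispersionDeriv_neg_left]
      ring
  rw [hodd]
  refine le_trans ?_ hfin
  have : 0 ≤ 1 - η - max (2 - α) (1 / 2) := by linarith
  gcongr

end Dispersion

section Lattice

open scoped RealInnerProductSpace

/-- The embedding of the lattice `ℤ³` into Euclidean space. -/
def latticeEmb : (Fin 3 → ℤ) →+ EuclideanSpace ℝ (Fin 3) where
  toFun n := WithLp.toLp 2 (fun i => (n i : ℝ))
  map_zero' := by ext i; simp
  map_add' m n := by ext i; simp

lemma latticeEmb_apply (n : Fin 3 → ℤ) (i : Fin 3) : latticeEmb n i = n i := rfl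

lemma norm_latticeEmb (n : Fin 3 → ℤ) :
    ‖latticeEmb n‖ = Real.sqrt (∑ i, ((n i : ℝ)) ^ 2) := by
  simp [EuclideanSpace.norm_eq, latticeEmb_apply]

lemma latticeEmb_zsmul (t : ℤ) (n : Fin 3 → ℤ) : latticeEmb (t • n) = (t : ℝ) • latticeEmb n := by
  ext i
  simp [latticeEmb_apply]

lemma norm_latticeEmb_sub_sign_smul_le {σ : ℤ} (hσ : σ = 1 ∨ σ = -1) (m n : Fin 3 → ℤ) :
    ‖latticeEmb (m - σ • n)‖ ≤ ‖latticeEmb m‖ + ‖latticeEmb n‖ := by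
  rw [map_sub, latticeEmb_zsmul]
  refine (norm_sub_le _ _).trans ?_
  rw [norm_smul]
  rcases hσ with rfl | rfl <;> simp

lemma abs_le_norm_latticeEmb (n : Fin 3 → ℤ) (i : Fin 3) : (|n i| : ℝ) ≤ ‖latticeEmb n‖ := by
  simpa [latticeEmb_apply] using PiLp.norm_apply_le (latticeEmb n) i

lemma abs_le_of_norm_latticeEmb_le {n : Fin 3 → ℤ} {R : ℕ} (h : ‖latticeEmb n‖ ≤ R) (i : Fin 3) :
    |n i| ≤ R := by
  exact_mod_cast (abs_le_norm_latticeEmb n i).trans h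

lemma one_le_norm_latticeEmb {n : Fin 3 → ℤ} (hn : n ≠ 0) : 1 ≤ ‖latticeEmb n‖ := by
  obtain ⟨i, hi⟩ := Function.ne_iff.1 hn
  refine le_trans ?_ (abs_le_norm_latticeEmb n i)
  exact_mod_cast Int.one_le_abs hi

/-- The box of lattice points at sup-distance at most `R` from `c`. -/
def latticeBox (c : Fin 3 → ℤ) (R : ℕ) : Finset (Fin 3 → ℤ) :=
  Fintype.piFinset fun j => Finset.Icc (c j - R) (c j + R)

lemma mem_latticeBox {c n : Fin 3 → ℤ} {R : ℕ} : n ∈ latticeBox c R ↔ ∀ j, |n j - c j| ≤ R := by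
  simp only [latticeBox, Fintype.mem_piFinset, Finset.mem_Icc, abs_le]
  refine forall_congr' fun j => ?_
  constructor <;> rintro ⟨h1, h2⟩ <;> constructor <;> linarith

lemma mem_latticeBox_of_norm_le {c n : Fin 3 → ℤ} {R : ℕ} (h : ‖latticeEmb (n - c)‖ ≤ R) :
    n ∈ latticeBox c R :=
  mem_latticeBox.2 fun j => abs_le_of_norm_latticeEmb_le h j

lemma card_latticeBox_le (c : Fin 3 → ℤ) {R : ℕ} (hR : 1 ≤ R) :
    (latticeBox c R).card ≤ 27 * R ^ 3 := by
  have h : ∀ j, (Finset.Icc (c j - R) (c j + R)).card = 2 * R + 1 := fun j => by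
    rw [Int.card_Icc]; omega
  rw [latticeBox, Fintype.card_piFinset]
  simp only [h, Finset.prod_const, Finset.card_univ, Fintype.card_fin]
  calc (2 * R + 1) ^ 3 ≤ (3 * R) ^ 3 := Nat.pow_le_pow_left (by omega) 3
    _ = 27 * R ^ 3 := by ring

lemma Int.card_le_of_gaps {Q : Finset ℤ} {L : ℝ} (hL : 0 ≤ L)
    (h : ∀ p ∈ Q, ∀ q ∈ Q, p < q → ((q - p : ℤ) : ℝ) ≤ L) : (Q.card : ℝ) ≤ 1 + L := by
  rcases Q.eq_empty_or_nonempty with rfl | hQ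
  · simp; linarith
  · have hsub : Q ⊆ Finset.Icc (Q.min' hQ) (Q.min' hQ + ⌊L⌋) := by
      intro q hq
      have hle := Q.min'_le q hq
      refine Finset.mem_Icc.2 ⟨hle, ?_⟩
      rcases hle.eq_or_lt with h' | h'
      · rw [← h']
        have := Int.floor_nonneg.2 hL
        omega
      · have := Int.le_floor.2 (h _ (Q.min'_mem hQ) q hq h')
        omega
    have h1 := Finset.card_le_card hsub
    rw [Int.card_Icc] at h1
    have h2 : (Q.card : ℤ) ≤ 1 + ⌊L⌋ := by
      have := Int.floor_nonneg.2 hL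
      omega
    have h3 : (Q.card : ℝ) ≤ 1 + (⌊L⌋ : ℝ) := by exact_mod_cast h2
    linarith [Int.floor_le L]

/-- A set of lattice points in a box of radius `r` whose intersection with every line in the
direction `w` has diameter at most `L` (in units of `w`) has `O(r² (1 + L))` elements. -/
lemma card_le_of_line_gaps {B r : ℕ} {w : Fin 3 → ℤ} (hw : w ≠ 0) (hB : ∀ j, |w j| ≤ B)
    {A : Finset (Fin 3 → ℤ)} {c : Fin 3 → ℤ} (hr : 1 ≤ r) (hA : A ⊆ latticeBox c r)
    {L : ℝ} (hL : 0 ≤ L) (hgap : ∀ n ∈ A, ∀ t : ℤ, 0 < t → n + t • w ∈ A → (t : ℝ) ≤ L) :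
    (A.card : ℝ) ≤ 9 * (B + 1) ^ 3 * r ^ 2 * (1 + L) := by
  classical
  obtain ⟨i, hi⟩ := Function.ne_iff.1 hw
  have hi : w i ≠ 0 := hi
  let quo : (Fin 3 → ℤ) → ℤ := fun n => (n i - c i) / w i
  let rem : (Fin 3 → ℤ) → (Fin 3 → ℤ) := fun n => n - c - quo n • w
  let box : Finset (Fin 3 → ℤ) := Fintype.piFinset fun j =>
    if j = i then Finset.Icc 0 (B : ℤ) else Finset.Icc (-((1 + B) * r : ℤ)) ((1 + B) * r)
  have hmaps : ∀ n ∈ A, rem n ∈ box := by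
    intro n hn
    have hn' := mem_latticeBox.1 (hA hn)
    refine Fintype.mem_piFinset.2 fun j => ?_
    by_cases hj : j = i
    · subst hj
      have e : rem n j = (n j - c j) % w j := by
        simp only [rem, quo, Pi.sub_apply, Pi.smul_apply, smul_eq_mul, Int.emod_def]
        ring
      rw [if_pos rfl, e, Finset.mem_Icc]
      exact ⟨Int.emod_nonneg _ hi, ((Int.emod_lt_abs _ hi).le).trans (hB j)⟩
    · rw [if_neg hj, Finset.mem_Icc, ← abs_le]
      have hq : |quo n| ≤ r := (Int.abs_ediv_le_abs _ _).trans (hn' i)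
      calc |rem n j| ≤ |n j - c j| + |quo n * w j| := abs_sub _ _
        _ ≤ r + r * B := by
            rw [abs_mul]
            exact add_le_add (hn' j) (mul_le_mul hq (hB j) (abs_nonneg _) (by positivity))
        _ = (1 + B) * r := by ring
  have hbox : box.card ≤ 9 * (B + 1) ^ 3 * r ^ 2 := by
    rw [Fintype.card_piFinset, ← Finset.mul_prod_erase _ _ (Finset.mem_univ i), if_pos rfl]
    have h : ∀ j ∈ Finset.univ.erase i, (if j = i then Finset.Icc 0 (B : ℤ) else
        Finset.Icc (-((1 + B) * r : ℤ)) ((1 + B) * r)).card ≤ 3 * ((B + 1) * r) := by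
      intro j hj
      rw [if_neg (Finset.ne_of_mem_erase hj), Int.card_Icc]
      have h1 : 1 ≤ (B + 1) * r := Nat.mul_pos (by omega) hr
      have h2 : ((1 + B) * r : ℤ) = (((B + 1) * r : ℕ) : ℤ) := by push_cast; ring
      rw [h2]
      omega
    have h3 := Finset.prod_le_pow_card _ _ _ h
    rw [Finset.card_erase_of_mem (Finset.mem_univ i), Finset.card_univ, Fintype.card_fin] at h3
    calc _ ≤ (B + 1) * (3 * ((B + 1) * r)) ^ (3 - 1) := by
          refine Nat.mul_le_mul ?_ h3
          rw [Int.card_Icc]; omega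
      _ = _ := by ring
  have hfib : ∀ b ∈ box, (A.filter fun n => rem n = b).card ≤ ⌊1 + L⌋₊ := by
    intro b _
    refine Nat.le_floor ?_
    have hinj : Set.InjOn quo (A.filter fun n => rem n = b) := by
      intro n hn n' hn' hq
      have h1 := (Finset.mem_filter.1 hn).2
      have h2 := (Finset.mem_filter.1 hn').2
      have h3 : n - c - quo n • w = n' - c - quo n' • w := h1.trans h2.symm
      rw [hq] at h3
      simpa using h3
    rw [← Finset.card_image_of_injOn hinj]
    refine Int.card_le_of_gaps hL ?_
    intro p hp q hq hpq
    obtain ⟨n, hn, rfl⟩ := Finset.mem_image.1 hp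
    obtain ⟨n', hn', rfl⟩ := Finset.mem_image.1 hq
    rw [Finset.mem_filter] at hn hn'
    refine hgap n hn.1 _ (by omega) ?_
    have h3 : n - c - quo n • w = n' - c - quo n' • w := hn.2.trans hn'.2.symm
    have h4 : n + (quo n' - quo n) • w = n' := by
      rw [sub_smul]
      linear_combination h3
    rw [h4]
    exact hn'.1
  have h5 := Finset.card_le_mul_card_image_of_maps_to hmaps ⌊1 + L⌋₊ hfib
  calc (A.card : ℝ) ≤ (⌊1 + L⌋₊ : ℝ) * box.card := by exact_mod_cast h5
    _ ≤ (1 + L) * (9 * (B + 1) ^ 3 * r ^ 2 : ℕ) := by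
        gcongr
        exact Nat.floor_le (by linarith)
    _ = _ := by push_cast; ring

/-- Every direction is approximated by integer vectors of bounded size. -/
lemma exists_lattice_direction {η : ℝ} (hη : 0 < η) :
    ∃ B : ℕ, ∀ d : Fin 3 → ℤ, d ≠ 0 → ∃ w : Fin 3 → ℤ, w ≠ 0 ∧ (∀ j, |w j| ≤ B) ∧
      (1 - η) * (‖latticeEmb d‖ * ‖latticeEmb w‖) ≤ ⟪latticeEmb d, latticeEmb w⟫ := by
  set K : ℝ := 2 / η + 2 with hK
  have hη2 : 0 < 2 / η := by positivity
  have hKη : K * η = 2 + 2 * η := by rw [hK]; field_simp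
  refine ⟨⌈K⌉₊ + 1, fun d hd => ?_⟩
  have hd1 := one_le_norm_latticeEmb hd
  have hd0 : 0 < ‖latticeEmb d‖ := by linarith
  set e : EuclideanSpace ℝ (Fin 3) := (K / ‖latticeEmb d‖) • latticeEmb d with he
  have henorm : ‖e‖ = K := by
    rw [he, norm_smul, Real.norm_of_nonneg (by positivity), div_mul_cancel₀ _ hd0.ne']
  let w : Fin 3 → ℤ := fun j => round (e j)
  have hclose : ‖latticeEmb w - e‖ ≤ 1 := by
    rw [EuclideanSpace.norm_eq]
    refine Real.sqrt_le_one.2 ?_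
    have h : ∀ i : Fin 3, ‖(latticeEmb w - e) i‖ ^ 2 ≤ 1 / 4 := by
      intro i
      have h1 : |e i - round (e i)| ≤ 1 / 2 := abs_sub_round (e i)
      have h2 : ‖(latticeEmb w - e) i‖ = |e i - round (e i)| := by
        rw [PiLp.sub_apply, latticeEmb_apply, Real.norm_eq_abs, abs_sub_comm]
      rw [h2]
      nlinarith [abs_nonneg (e i - round (e i))]
    calc _ ≤ ∑ _i : Fin 3, (1 / 4 : ℝ) := Finset.sum_le_sum fun i _ => h i
      _ ≤ 1 := by norm_num
  have hwle : ‖latticeEmb w‖ ≤ K + 1 := by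
    have := norm_le_insert' (latticeEmb w) e
    linarith
  refine ⟨w, ?_, fun j => ?_, ?_⟩
  · intro h0
    rw [h0, map_zero, zero_sub, norm_neg, henorm] at hclose
    linarith
  · refine abs_le_of_norm_latticeEmb_le (hwle.trans ?_) j
    push_cast
    linarith [Nat.le_ceil K]
  · have h1 : ⟪latticeEmb d, e⟫ = K * ‖latticeEmb d‖ := by
      rw [he, inner_smul_right, real_inner_self_eq_norm_sq]
      field_simp
    have h2 : ⟪latticeEmb d, latticeEmb w⟫ = ⟪latticeEmb d, e⟫ +
        ⟪latticeEmb d, latticeEmb w - e⟫ := by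
      rw [← inner_add_right, add_sub_cancel]
    have h3 : -(‖latticeEmb d‖ * 1) ≤ ⟪latticeEmb d, latticeEmb w - e⟫ := by
      refine (abs_le.1 ((abs_real_inner_le_norm _ _).trans ?_)).1
      gcongr
    rw [h2, h1]
    rcases le_total η 1 with h | h
    · have : (1 - η) * (‖latticeEmb d‖ * ‖latticeEmb w‖) ≤
          (1 - η) * (‖latticeEmb d‖ * (K + 1)) := by
        have : 0 ≤ 1 - η := by linarith
        gcongr
      nlinarith
    · have : (1 - η) * (‖latticeEmb d‖ * ‖latticeEmb w‖) ≤ 0 :=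
        mul_nonpos_of_nonpos_of_nonneg (by linarith) (by positivity)
      nlinarith

/-- Counting lattice points `n` for which the two-frequency phase `⟨n⟩ + σ ⟨q - n⟩` lies in a fixed
interval and the relative frequency `n - σ (q - n)` has size at least `ρ`. -/
lemma exists_card_pair_le {α : ℝ} (hα : 1 < α) (hα₂ : α ≤ 2) :
    ∃ C : ℝ, 0 < C ∧ ∀ σ : ℤ, (σ = 1 ∨ σ = -1) → ∀ (A : Finset (Fin 3 → ℤ)) (c q : Fin 3 → ℤ)
      (r : ℕ) (M ρ ζ : ℝ), 1 ≤ r → 1 ≤ M → 0 < ρ → A ⊆ latticeBox c r →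
      (∀ n ∈ A, ‖latticeEmb n‖ ≤ M ∧ ‖latticeEmb (q - n)‖ ≤ M ∧
        ρ ≤ ‖latticeEmb (n - σ • (q - n))‖ ∧
        |dispersion α (latticeEmb n) + σ * dispersion α (latticeEmb (q - n)) - ζ| ≤ 1) →
      (A.card : ℝ) ≤ C * (r ^ 2 * (1 + M / ρ)) := by
  classical
  set θ : ℝ := max (2 - α) (1 / 2) with hθ
  have hθ1 : θ < 1 := max_lt (by linarith) (by norm_num)
  have hη : 0 < (1 - θ) / 2 := by linarith
  obtain ⟨B, hB⟩ := exists_lattice_direction hη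
  choose! dir hdir using hB
  set K : ℝ := 1 + 8 / (1 - θ) with hK
  have hθ0 : 0 < 1 - θ := by linarith
  have hK1 : 1 ≤ K := by rw [hK]; linarith [show 0 < 8 / (1 - θ) by positivity]
  refine ⟨27 * (B + 1) ^ 3 * (9 * (B + 1) ^ 3 * K), by positivity, ?_⟩
  intro σ hσ A c q r M ρ ζ hr hM hρ hAbox hA
  have hσR : (σ : ℝ) = 1 ∨ (σ : ℝ) = -1 := by
    rcases hσ with rfl | rfl <;> simp
  let rel : (Fin 3 → ℤ) → (Fin 3 → ℤ) := fun n => n - σ • (q - n)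
  have hrel : ∀ n, latticeEmb (rel n) =
      latticeEmb n - (σ : ℝ) • (latticeEmb q - latticeEmb n) := fun n => by
    simp only [rel]
    rw [map_sub, latticeEmb_zsmul, map_sub]
  have hrel0 : ∀ n ∈ A, rel n ≠ 0 := fun n hn h0 => by
    have h1 : ρ ≤ ‖latticeEmb (rel n)‖ := (hA n hn).2.2.1
    rw [h0, map_zero, norm_zero] at h1
    linarith
  have hmaps : ∀ n ∈ A, dir (rel n) ∈ latticeBox 0 (B + 1) := fun n hn =>
    mem_latticeBox.2 fun j => by
      have := (hdir _ (hrel0 n hn)).2.1 j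
      simp only [Pi.zero_apply, sub_zero]
      push_cast
      linarith
  have hfib : ∀ w ∈ latticeBox 0 (B + 1), (A.filter fun n => dir (rel n) = w).card ≤
      ⌊9 * (B + 1) ^ 3 * r ^ 2 * (1 + 8 / (1 - θ) * (M / ρ))⌋₊ := by
    intro w _
    refine Nat.le_floor ?_
    rcases (A.filter fun n => dir (rel n) = w).eq_empty_or_nonempty with h0 | ⟨n₀, hn₀⟩
    · rw [h0]
      simp only [Finset.card_empty, Nat.cast_zero]
      positivity
    obtain ⟨hn₀A, hn₀w⟩ := Finset.mem_filter.1 hn₀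
    have hw0 : w ≠ 0 := hn₀w ▸ (hdir _ (hrel0 _ hn₀A)).1
    refine card_le_of_line_gaps hw0 (hn₀w ▸ (hdir _ (hrel0 _ hn₀A)).2.1) hr
      ((Finset.filter_subset _ _).trans hAbox) (by positivity) ?_
    intro n hn t ht hnt
    obtain ⟨hnA, hnw⟩ := Finset.mem_filter.1 hn
    obtain ⟨hntA, -⟩ := Finset.mem_filter.1 hnt
    obtain ⟨a1, a2, a3, a4⟩ := hA n hnA
    obtain ⟨b1, b2, -, b4⟩ := hA _ hntA
    have hcone := (hdir _ (hrel0 _ hnA)).2.2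
    rw [hnw, hrel] at hcone
    have a3 : ρ ≤ ‖latticeEmb (rel n)‖ := a3
    rw [hrel] at a3
    simp only [map_sub, map_add, latticeEmb_zsmul] at a2 a4 b1 b2 b4
    have htR : (0 : ℝ) < t := by exact_mod_cast ht
    have hgrow := pair_phase_growth hα hα₂ hη.le (by linarith) hσR htR hcone a1 b1 a2 b2
    have hdiff := hgrow.trans (show _ ≤ (2 : ℝ) by
      have := (abs_le.1 b4).2
      have := (abs_le.1 a4).1
      linarith)
    have hw1 := one_le_norm_latticeEmb hw0
    have hsqrt : Real.sqrt (1 + M ^ 2) ≤ 2 * M := by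
      rw [Real.sqrt_le_left (by linarith)]
      nlinarith
    have hlow : (1 - θ) / 2 * (ρ * 1) / (2 * M) * t ≤ 2 := by
      refine le_trans ?_ hdiff
      have : 1 - (1 - θ) / 2 - θ = (1 - θ) / 2 := by ring
      rw [← hθ, this]
      gcongr
    have e1 : (1 - θ) / 2 * (ρ * 1) / (2 * M) * t = (1 - θ) * ρ * t / (4 * M) := by
      field_simp
      ring
    rw [e1, div_le_iff₀ (by positivity)] at hlow
    rw [div_mul_div_comm, le_div_iff₀ (by positivity)]
    nlinarith
  have h5 := Finset.card_le_mul_card_image_of_maps_to hmaps _ hfib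
  have h6 := card_latticeBox_le 0 (Nat.succ_pos B)
  have hq : 0 ≤ M / ρ := by positivity
  calc (A.card : ℝ) ≤ (⌊9 * (B + 1) ^ 3 * r ^ 2 * (1 + 8 / (1 - θ) * (M / ρ))⌋₊ : ℝ) *
        (latticeBox 0 (B + 1)).card := by exact_mod_cast h5
    _ ≤ (9 * (B + 1) ^ 3 * r ^ 2 * (K * (1 + M / ρ))) * (27 * (B + 1) ^ 3 : ℕ) := by
        gcongr
        refine (Nat.floor_le (by positivity)).trans ?_
        gcongr
        rw [hK]
        have : 0 < 8 / (1 - θ) := by positivity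
        nlinarith
    _ = _ := by push_cast; ring

lemma card_le_card_mul_of_sections {β γ : Type*} [DecidableEq β] [DecidableEq γ]
    {T : Finset (β × γ)} {X : Finset β} {b : ℝ} (hb : 0 ≤ b) (hX : ∀ z ∈ T, z.1 ∈ X)
    (h : ∀ x ∈ X, ∀ A : Finset γ, (∀ y ∈ A, (x, y) ∈ T) → (A.card : ℝ) ≤ b) :
    (T.card : ℝ) ≤ X.card * b := by
  have hfib : ∀ x ∈ X, (T.filter fun z => z.1 = x).card ≤ ⌊b⌋₊ := by
    intro x hx
    refine Nat.le_floor ?_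
    have hinj : Set.InjOn Prod.snd ((T.filter fun z => z.1 = x : Finset (β × γ)) : Set (β × γ)) := by
      intro z hz z' hz' hzz
      have h1 := (Finset.mem_filter.1 hz).2
      have h2 := (Finset.mem_filter.1 hz').2
      exact Prod.ext (h1.trans h2.symm) hzz
    rw [← Finset.card_image_of_injOn hinj]
    refine h x hx _ fun y hy => ?_
    obtain ⟨z, hz, rfl⟩ := Finset.mem_image.1 hy
    obtain ⟨hzT, rfl⟩ := Finset.mem_filter.1 hz
    exact hzT
  have h5 := Finset.card_le_mul_card_image_of_maps_to hX _ hfib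
  calc (T.card : ℝ) ≤ (⌊b⌋₊ : ℝ) * X.card := by exact_mod_cast h5
    _ ≤ b * X.card := by gcongr; exact Nat.floor_le hb
    _ = _ := mul_comm _ _

/-- Counting pairs of frequencies whose relative frequency lies in a dyadic shell. -/
lemma exists_card_shell_le {α : ℝ} (hα : 1 < α) (hα₂ : α ≤ 2) :
    ∃ C : ℝ, 0 < C ∧ ∀ σ : ℤ, (σ = 1 ∨ σ = -1) →
      ∀ (T : Finset ((Fin 3 → ℤ) × (Fin 3 → ℤ))) (p : Fin 3 → ℤ) (h : (Fin 3 → ℤ) → ℝ) (N R : ℕ),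
      1 ≤ N → 1 ≤ R →
      (∀ z ∈ T, ‖latticeEmb z.1‖ ≤ N ∧ ‖latticeEmb z.2‖ ≤ N ∧ ‖latticeEmb (p - z.1 - z.2)‖ ≤ N ∧
        |dispersion α (latticeEmb z.2) + σ * dispersion α (latticeEmb (p - z.1 - z.2)) - h z.1| ≤ 1 ∧
        R ≤ ‖latticeEmb (z.2 - σ • (p - z.1 - z.2))‖ ∧
        ‖latticeEmb (z.2 - σ • (p - z.1 - z.2))‖ < 2 * R) →
      (T.card : ℝ) ≤ C * (R * N ^ 4) := by
  classical
  obtain ⟨C, hC, hpair⟩ := exists_card_pair_le hα hα₂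
  refine ⟨27 * 8 * 12 * C, by positivity, ?_⟩
  intro σ hσ T p h N R hN hR hT
  have hNR : (1 : ℝ) ≤ N := by exact_mod_cast hN
  have hRR : (1 : ℝ) ≤ R := by exact_mod_cast hR
  rcases T.eq_empty_or_nonempty with rfl | ⟨z₀, hz₀⟩
  · simp only [Finset.card_empty, Nat.cast_zero]
    positivity
  have hRN : (R : ℝ) ≤ 2 * N := by
    obtain ⟨-, h2, h3, -, h5, -⟩ := hT z₀ hz₀
    refine h5.trans ?_
    have := norm_latticeEmb_sub_sign_smul_le hσ z₀.2 (p - z₀.1 - z₀.2)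
    linarith
  have hsec : ∀ (c : Fin 3 → ℤ) (r : ℕ), 1 ≤ r → ∀ x, ∀ A : Finset (Fin 3 → ℤ),
      A ⊆ latticeBox c r → (∀ y ∈ A, (x, y) ∈ T) → (A.card : ℝ) ≤ C * (r ^ 2 * (1 + N / R)) := by
    intro c r hr x A hAc hA
    refine hpair σ hσ A c (p - x) r N R (h x) hr hNR (by linarith) hAc fun y hy => ?_
    obtain ⟨-, h2, h3, h4, h5, -⟩ := hT _ (hA y hy)
    exact ⟨h2, h3, h5, h4⟩
  have hdiv : 1 + (N : ℝ) / R ≤ 3 * N / R := by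
    rw [← sub_nonneg]
    have : 3 * (N : ℝ) / R - (1 + N / R) = (2 * N - R) / R := by field_simp; ring
    rw [this]
    exact div_nonneg (by linarith) (by linarith)
  rcases hσ with rfl | rfl
  · have hX : ∀ z ∈ T, z.1 ∈ latticeBox 0 N := fun z hz =>
      mem_latticeBox_of_norm_le (by simpa using (hT z hz).1)
    have hcard := card_le_card_mul_of_sections (b := C * ((2 * R : ℕ) ^ 2 * (1 + N / R)))
      (by positivity) hX (fun x _ A hA => by
        rcases A.eq_empty_or_nonempty with rfl | ⟨y₀, hy₀⟩
        · simp only [Finset.card_empty, Nat.cast_zero]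
          positivity
        refine hsec y₀ (2 * R) (by omega) x A (fun y hy => ?_) hA
        refine mem_latticeBox_of_norm_le ?_
        have h1 := (hT _ (hA y hy)).2.2.2.2.2
        have h2 := (hT _ (hA y₀ hy₀)).2.2.2.2.2
        simp only [one_smul] at h1 h2
        have e : latticeEmb (y - (p - x - y)) - latticeEmb (y₀ - (p - x - y₀)) =
            (2 : ℝ) • latticeEmb (y - y₀) := by
          simp only [map_sub]
          module
        have h3 := norm_sub_le (latticeEmb (y - (p - x - y))) (latticeEmb (y₀ - (p - x - y₀)))
        rw [e, norm_smul, Real.norm_of_nonneg (by norm_num)] at h3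
        push_cast
        linarith)
    refine hcard.trans ?_
    have hb : ((latticeBox 0 N).card : ℝ) ≤ 27 * N ^ 3 := by
      exact_mod_cast card_latticeBox_le 0 hN
    calc _ ≤ (27 * (N : ℝ) ^ 3) * (C * ((2 * R : ℕ) ^ 2 * (3 * N / R))) := by gcongr
      _ = 27 * 12 * C * (R * N ^ 4) := by push_cast; field_simp; ring
      _ ≤ _ := by
        gcongr
        norm_num
  · have hX : ∀ z ∈ T, z.1 ∈ latticeBox p (2 * R) := fun z hz => by
      refine mem_latticeBox_of_norm_le ?_
      have h1 := (hT z hz).2.2.2.2.2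
      have e : z.2 - (-1 : ℤ) • (p - z.1 - z.2) = -(z.1 - p) := by
        rw [neg_one_smul]; abel
      rw [e, map_neg, norm_neg] at h1
      push_cast
      exact h1.le
    have hcard := card_le_card_mul_of_sections (b := C * (N ^ 2 * (1 + N / R)))
      (by positivity) hX (fun x _ A hA =>
        hsec 0 N hN x A (fun y hy =>
          mem_latticeBox_of_norm_le (by simpa using (hT _ (hA y hy)).2.1)) hA)
    refine hcard.trans ?_
    have hb : ((latticeBox p (2 * R)).card : ℝ) ≤ 27 * (2 * R) ^ 3 := by
      exact_mod_cast card_latticeBox_le p (by omega)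
    calc _ ≤ (27 * (2 * (R : ℝ)) ^ 3) * (C * (N ^ 2 * (3 * N / R))) := by gcongr
      _ = 27 * 8 * 3 * C * (R * N ^ 3 * R) := by field_simp; norm_num
      _ ≤ 27 * 8 * 3 * C * (R * N ^ 3 * (2 * N)) := by gcongr
      _ ≤ 27 * 8 * 12 * C * (R * N ^ 4) := by
        have : 0 ≤ C * (R * (N : ℝ) ^ 4) := by positivity
        nlinarith

/-- Counting pairs of frequencies in a common ball of radius `N`. -/
lemma exists_card_comparable_le {α : ℝ} (hα : 1 < α) (hα₂ : α ≤ 2) :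
    ∃ C : ℝ, 0 < C ∧ ∀ σ : ℤ, (σ = 1 ∨ σ = -1) →
      ∀ (T : Finset ((Fin 3 → ℤ) × (Fin 3 → ℤ))) (p : Fin 3 → ℤ) (h : (Fin 3 → ℤ) → ℝ) (N : ℕ),
      1 ≤ N →
      (∀ z ∈ T, ‖latticeEmb z.1‖ ≤ N ∧ ‖latticeEmb z.2‖ ≤ N ∧ ‖latticeEmb (p - z.1 - z.2)‖ ≤ N ∧
        |dispersion α (latticeEmb z.2) + σ * dispersion α (latticeEmb (p - z.1 - z.2)) - h z.1|
          ≤ 1) →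
      (T.card : ℝ) ≤ C * N ^ 5 := by
  classical
  obtain ⟨C, hC, hshell⟩ := exists_card_shell_le hα hα₂
  refine ⟨(C + 27) * 4, by positivity, ?_⟩
  intro σ hσ T p h N hN hT
  have hNR : (1 : ℝ) ≤ N := by exact_mod_cast hN
  let rel : (Fin 3 → ℤ) × (Fin 3 → ℤ) → (Fin 3 → ℤ) := fun z => z.2 - σ • (p - z.1 - z.2)
  have hind : ∀ i : ℕ, ((T.filter fun z => ‖latticeEmb (rel z)‖ < (2 ^ i : ℕ)).card : ℝ) ≤
      (C + 27) * ((2 ^ i : ℕ) * N ^ 4) := by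
    intro i
    induction i with
    | zero =>
      have hrel : ∀ z ∈ T.filter (fun z => ‖latticeEmb (rel z)‖ < (2 ^ 0 : ℕ)), rel z = 0 := by
        intro z hz
        by_contra h0
        have := (Finset.mem_filter.1 hz).2
        have := one_le_norm_latticeEmb h0
        simp at *
        linarith
      have hX : ∀ z ∈ T.filter (fun z => ‖latticeEmb (rel z)‖ < (2 ^ 0 : ℕ)),
          z.2 ∈ latticeBox 0 N := fun z hz =>
        mem_latticeBox_of_norm_le (by simpa using (hT z (Finset.mem_filter.1 hz).1).2.1)
      have hinj : Set.InjOn Prod.snd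
          ((T.filter (fun z => ‖latticeEmb (rel z)‖ < (2 ^ 0 : ℕ)) : Finset _) :
            Set ((Fin 3 → ℤ) × (Fin 3 → ℤ))) := by
        intro z hz z' hz' hzz
        have h1 : z.2 - σ • (p - z.1 - z.2) = z'.2 - σ • (p - z'.1 - z'.2) :=
          (hrel z hz).trans (hrel z' hz').symm
        rw [hzz] at h1
        refine Prod.ext ?_ hzz
        rcases hσ with rfl | rfl <;> simpa using h1
      have h1 := (Finset.card_le_card_of_injOn _ hX hinj).trans (card_latticeBox_le 0 hN)
      calc _ ≤ (27 : ℝ) * N ^ 3 := by exact_mod_cast h1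
        _ ≤ (C + 27) * ((2 ^ 0 : ℕ) * N ^ 4) := by
          simp only [pow_zero, Nat.cast_one, one_mul]
          gcongr
          · linarith
          · norm_num
    | succ i ih =>
      have hsplit : T.filter (fun z => ‖latticeEmb (rel z)‖ < (2 ^ (i + 1) : ℕ)) ⊆
          T.filter (fun z => ‖latticeEmb (rel z)‖ < (2 ^ i : ℕ)) ∪
          T.filter (fun z => ((2 ^ i : ℕ) : ℝ) ≤ ‖latticeEmb (rel z)‖ ∧
            ‖latticeEmb (rel z)‖ < 2 * (2 ^ i : ℕ)) := by
        intro z hz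
        obtain ⟨hzT, hz⟩ := Finset.mem_filter.1 hz
        rw [Finset.mem_union, Finset.mem_filter, Finset.mem_filter]
        rcases lt_or_ge ‖latticeEmb (rel z)‖ ((2 ^ i : ℕ) : ℝ) with h1 | h1
        · exact Or.inl ⟨hzT, h1⟩
        · refine Or.inr ⟨hzT, h1, ?_⟩
          rw [pow_succ'] at hz
          exact_mod_cast hz
      have h1 := hshell σ hσ (T.filter (fun z => ((2 ^ i : ℕ) : ℝ) ≤ ‖latticeEmb (rel z)‖ ∧
            ‖latticeEmb (rel z)‖ < 2 * (2 ^ i : ℕ))) p h N (2 ^ i) hN Nat.one_le_two_pow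
        (fun z hz => by
          obtain ⟨hzT, hz1, hz2⟩ := Finset.mem_filter.1 hz
          obtain ⟨a1, a2, a3, a4⟩ := hT z hzT
          exact ⟨a1, a2, a3, a4, hz1, hz2⟩)
      have h2 := (Finset.card_le_card hsplit).trans (Finset.card_union_le _ _)
      have h3 : ((T.filter (fun z => ‖latticeEmb (rel z)‖ < (2 ^ (i + 1) : ℕ))).card : ℝ) ≤ _ :=
        (Nat.cast_le.2 h2)
      rw [Nat.cast_add] at h3
      have h4 : 0 ≤ ((2 ^ i : ℕ) * (N : ℝ) ^ 4) := by positivity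
      have h5 : (((2 ^ (i + 1) : ℕ) : ℝ) * (N : ℝ) ^ 4) = 2 * ((2 ^ i : ℕ) * (N : ℝ) ^ 4) := by
        push_cast; ring
      rw [h5]
      nlinarith
  obtain ⟨i, hi1, hi2⟩ : ∃ i : ℕ, 2 * N < 2 ^ i ∧ 2 ^ i ≤ 4 * N := by
    refine ⟨Nat.log 2 N + 2, ?_, ?_⟩
    · have := Nat.lt_pow_succ_log_self (b := 2) (by norm_num) N
      rw [pow_succ] at this ⊢
      omega
    · have := Nat.pow_log_le_self 2 (x := N) (by omega)
      rw [pow_add]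
      omega
  have hall : T.filter (fun z => ‖latticeEmb (rel z)‖ < (2 ^ i : ℕ)) = T := by
    refine Finset.filter_true_of_mem fun z hz => ?_
    obtain ⟨-, h2, h3, -⟩ := hT z hz
    have hlt : (2 * N : ℝ) < (2 ^ i : ℕ) := by exact_mod_cast hi1
    refine lt_of_le_of_lt ?_ hlt
    have := norm_latticeEmb_sub_sign_smul_le hσ z.2 (p - z.1 - z.2)
    linarith
  have hfin := hind i
  rw [hall] at hfin
  have hi2' : ((2 ^ i : ℕ) : ℝ) ≤ 4 * N := by exact_mod_cast hi2
  calc (T.card : ℝ) ≤ (C + 27) * ((2 ^ i : ℕ) * N ^ 4) := hfin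
    _ ≤ (C + 27) * ((4 * N) * N ^ 4) := by gcongr
    _ = _ := by ring

/-- Counting pairs of frequencies with three frequencies of sizes `N₃ ≤ N₂ ≤ N₁` and fixed sum. -/
lemma exists_card_triple_le {α : ℝ} (hα : 1 < α) (hα₂ : α ≤ 2) :
    ∃ C : ℝ, 0 < C ∧ ∀ σ : ℤ, (σ = 1 ∨ σ = -1) →
      ∀ (T : Finset ((Fin 3 → ℤ) × (Fin 3 → ℤ))) (p : Fin 3 → ℤ) (h : (Fin 3 → ℤ) → ℝ)
      (N₁ N₂ N₃ : ℕ), 1 ≤ N₃ → N₃ ≤ N₂ → N₂ ≤ N₁ →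
      (∀ z ∈ T, ‖latticeEmb z.1‖ ≤ N₂ ∧ ‖latticeEmb z.2‖ ≤ N₃ ∧
        ‖latticeEmb (p - z.1 - z.2)‖ ≤ N₁ ∧
        (2 ≤ N₁ → (N₁ : ℝ) / 2 < ‖latticeEmb (p - z.1 - z.2)‖) ∧
        |dispersion α (latticeEmb z.2) + σ * dispersion α (latticeEmb (p - z.1 - z.2)) - h z.1|
          ≤ 1) →
      (T.card : ℝ) ≤ C * (N₂ ^ 3 * N₃ ^ 2) := by
  classical
  obtain ⟨C, hC, hcomp⟩ := exists_card_comparable_le hα hα₂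
  obtain ⟨C', hC', hpair⟩ := exists_card_pair_le hα hα₂
  refine ⟨C * 4 ^ 5 + 27 * (C' * 5), by positivity, ?_⟩
  intro σ hσ T p h N₁ N₂ N₃ h3 h32 h21 hT
  have h3R : (1 : ℝ) ≤ N₃ := by exact_mod_cast h3
  have h32R : (N₃ : ℝ) ≤ N₂ := by exact_mod_cast h32
  have h21R : (N₂ : ℝ) ≤ N₁ := by exact_mod_cast h21
  have hpos : 0 ≤ ((N₂ : ℝ) ^ 3 * N₃ ^ 2) := by positivity
  rcases lt_or_ge N₁ (4 * N₃) with hlt | hge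
  · have hltR : (N₁ : ℝ) ≤ 4 * N₃ := by exact_mod_cast hlt.le
    have h1 := hcomp σ hσ T p h N₁ (by omega) fun z hz => by
      obtain ⟨a1, a2, a3, -, a5⟩ := hT z hz
      exact ⟨by linarith, by linarith, a3, a5⟩
    calc (T.card : ℝ) ≤ C * N₁ ^ 5 := h1
      _ ≤ C * (4 * N₃) ^ 5 := by gcongr
      _ = C * 4 ^ 5 * (N₃ ^ 3 * N₃ ^ 2) := by ring
      _ ≤ C * 4 ^ 5 * (N₂ ^ 3 * N₃ ^ 2) := by gcongr
      _ ≤ _ := by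
        gcongr
        linarith
  · have hgeR : (4 * N₃ : ℝ) ≤ N₁ := by exact_mod_cast hge
    have hX : ∀ z ∈ T, z.1 ∈ latticeBox 0 N₂ := fun z hz =>
      mem_latticeBox_of_norm_le (by simpa using (hT z hz).1)
    have hcard := card_le_card_mul_of_sections (b := C' * (N₃ ^ 2 * (1 + N₁ / (N₁ / 4))))
      (by positivity) hX (fun x _ A hA => by
        refine hpair σ hσ A 0 (p - x) N₃ N₁ (N₁ / 4) (h x) h3 (by linarith) (by linarith)
          (fun y hy => mem_latticeBox_of_norm_le (by simpa using (hT _ (hA y hy)).2.1))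
          fun y hy => ?_
        obtain ⟨-, a2, a3, a4, a5⟩ := hT _ (hA y hy)
        refine ⟨by linarith, a3, ?_, a5⟩
        have a4 := a4 (by omega)
        simp only at a2 a4
        rw [map_sub, latticeEmb_zsmul]
        have h6 := norm_sub_norm_le ((σ : ℝ) • latticeEmb (p - x - y)) (latticeEmb y)
        rw [norm_sub_rev, norm_smul] at h6
        have h7 : ‖(σ : ℝ)‖ = 1 := by rcases hσ with rfl | rfl <;> simp
        rw [h7] at h6
        linarith)
    have hb : ((latticeBox 0 N₂).card : ℝ) ≤ 27 * N₂ ^ 3 := by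
      exact_mod_cast card_latticeBox_le 0 (by omega)
    have hN0 : (N₁ : ℝ) ≠ 0 := by linarith
    have e : (1 : ℝ) + N₁ / (N₁ / 4) = 5 := by field_simp; norm_num
    rw [e] at hcard
    calc (T.card : ℝ) ≤ _ := hcard
      _ ≤ (27 * N₂ ^ 3) * (C' * (N₃ ^ 2 * 5)) := by gcongr
      _ = 27 * (C' * 5) * (N₂ ^ 3 * N₃ ^ 2) := by ring
      _ ≤ _ := by
        gcongr
        linarith [show 0 < C * 4 ^ 5 by positivity]

end Lattice

section Tuples

lemma znorm_eq_norm (n : Fin 3 → ℤ) : znorm n = ‖latticeEmb n‖ := (norm_latticeEmb n).symm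

lemma jbb_eq_dispersion (α : ℝ) (n : Fin 3 → ℤ) : jbb α n = dispersion α (latticeEmb n) := by
  have h : 0 ≤ ∑ i, ((n i : ℝ)) ^ 2 := Finset.sum_nonneg fun i _ => sq_nonneg _
  have e : jb n ^ (2 * α) = (1 + ‖latticeEmb n‖ ^ 2) ^ α := by
    rw [norm_latticeEmb, Real.sq_sqrt h, jb, Real.sqrt_eq_rpow, ← Real.rpow_mul (by linarith)]
    congr 1
    ring
  rw [jbb, dispersion, e]

lemma SimFreq.norm_le {N : ℕ} (hN : 1 ≤ N) {n : Fin 3 → ℤ} (h : SimFreq N n) :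
    ‖latticeEmb n‖ ≤ N := by
  rw [← znorm_eq_norm]
  have : (1 : ℝ) ≤ N := by exact_mod_cast hN
  rcases h with h | h
  · exact h.2.2
  · linarith [h.2]

lemma SimFreq.lt_norm {N : ℕ} (hN : 2 ≤ N) {n : Fin 3 → ℤ} (h : SimFreq N n) :
    (N : ℝ) / 2 < ‖latticeEmb n‖ := by
  rw [← znorm_eq_norm]
  have : (2 : ℝ) ≤ N := by exact_mod_cast hN
  rcases h with h | h
  · exact h.2.1
  · linarith [h.1]

/-- The indices of the three largest entries of a tuple of length at least three. -/
lemma exists_three_largest {k : ℕ} (hk : 3 ≤ k) (N : Fin k → ℕ) :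
    ∃ i₁ i₂ i₃ : Fin k, i₁ ≠ i₂ ∧ i₁ ≠ i₃ ∧ i₂ ≠ i₃ ∧ N i₃ ≤ N i₂ ∧ N i₂ ≤ N i₁ ∧
      (∀ j, N j ≤ N i₁) ∧ ∀ j, j ≠ i₁ → j ≠ i₂ → N j ≤ N i₃ := by
  classical
  obtain ⟨i₁, -, h1⟩ := Finset.exists_max_image (Finset.univ : Finset (Fin k)) N
    ⟨⟨0, by omega⟩, Finset.mem_univ _⟩
  obtain ⟨i₂, hi₂, h2⟩ := Finset.exists_max_image (Finset.univ.erase i₁) N (by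
    rw [← Finset.card_pos, Finset.card_erase_of_mem (Finset.mem_univ _)]
    simp
    omega)
  obtain ⟨i₃, hi₃, h3⟩ := Finset.exists_max_image ((Finset.univ.erase i₁).erase i₂) N (by
    rw [← Finset.card_pos, Finset.card_erase_of_mem hi₂,
      Finset.card_erase_of_mem (Finset.mem_univ _)]
    simp
    omega)
  simp only [Finset.mem_erase, Finset.mem_univ, and_true] at hi₂ hi₃ h1 h2 h3
  exact ⟨i₁, i₂, i₃, hi₂.symm, hi₃.2.symm, hi₃.1.symm, h2 _ hi₃.2, h1 _ trivial,
    fun j => h1 j trivial, fun j hj1 hj2 => h3 j ⟨hj2, hj1⟩⟩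

lemma thirdMax_eq {k : ℕ} {N : Fin k → ℝ} {i₁ i₂ i₃ : Fin k} (h12 : i₁ ≠ i₂) (h13 : i₁ ≠ i₃)
    (h23 : i₂ ≠ i₃) (h32 : N i₃ ≤ N i₂) (h21 : N i₂ ≤ N i₁)
    (h : ∀ j, j ≠ i₁ → j ≠ i₂ → N j ≤ N i₃) : thirdMax N = N i₃ := by
  refine IsGreatest.csSup_eq ⟨⟨i₁, i₂, i₃, h12, h13, h23, ?_⟩, ?_⟩
  · rw [min_eq_right h32, min_eq_right (h32.trans h21)]
  · rintro x ⟨i, j, l, hij, hil, hjl, rfl⟩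
    by_cases hi : i ≠ i₁ ∧ i ≠ i₂
    · exact (min_le_left _ _).trans (h i hi.1 hi.2)
    by_cases hj : j ≠ i₁ ∧ j ≠ i₂
    · exact ((min_le_right _ _).trans (min_le_left _ _)).trans (h j hj.1 hj.2)
    · refine ((min_le_right _ _).trans (min_le_right _ _)).trans (h l ?_ ?_) <;> grind

lemma sSup_range_eq_of_forall_le {k : ℕ} {N : Fin k → ℝ} {i : Fin k} (h : ∀ j, N j ≤ N i) :
    sSup (Set.range N) = N i :=
  IsGreatest.csSup_eq ⟨⟨i, rfl⟩, by rintro _ ⟨j, rfl⟩; exact h j⟩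

lemma sum_eq_three_add_compl {ι M : Type*} [Fintype ι] [DecidableEq ι] [AddCommMonoid M]
    {i₁ i₂ i₃ : ι} (h12 : i₁ ≠ i₂) (h13 : i₁ ≠ i₃) (h23 : i₂ ≠ i₃) (f : ι → M) :
    ∑ j, f j = f i₁ + (f i₂ + f i₃) + ∑ j ∈ ({i₁, i₂, i₃} : Finset ι)ᶜ, f j := by
  rw [← Finset.sum_add_sum_compl {i₁, i₂, i₃} f, Finset.sum_insert (by simp [h12, h13]),
    Finset.sum_pair h23]

lemma prod_eq_three_mul_compl {ι M : Type*} [Fintype ι] [DecidableEq ι] [CommMonoid M]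
    {i₁ i₂ i₃ : ι} (h12 : i₁ ≠ i₂) (h13 : i₁ ≠ i₃) (h23 : i₂ ≠ i₃) (f : ι → M) :
    ∏ j, f j = f i₁ * (f i₂ * f i₃) * ∏ j ∈ ({i₁, i₂, i₃} : Finset ι)ᶜ, f j := by
  rw [← Finset.prod_mul_prod_compl {i₁, i₂, i₃} f, Finset.prod_insert (by simp [h12, h13]),
    Finset.prod_pair h23]

end Tuples

/-- **Counting estimate with fixed total frequency** (supremum counting lemma of
Section 3.2): for `k ≥ 3` and `1 < α ≤ 2` there is `C = C(α,k) > 0`, uniform in the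
choice of signs, such that for all dyadic `N₁,…,N_k ≥ 1`, all `ζ ∈ ℝ` and all `n ∈ ℤ³`,
`#{ (n₁,…,n_k) : |n_j| ∼ N_j, n = Σ_j n_j, |κ − ζ| ≤ 1 }
  ≤ C · (max N_j)⁻³ · (max₍₃₎ N_j)⁻¹ · Π_j N_j³`. -/
theorem fixed_total_frequency_counting (k : ℕ) (hk : 3 ≤ k) (α : ℝ)
    (hα₁ : 1 < α) (hα₂ : α ≤ 2) :
    ∃ C : ℝ, 0 < C ∧
      ∀ εsum : ℝ, IsSign εsum → ∀ ε : Fin k → ℝ, (∀ j, IsSign (ε j)) →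
        ∀ Nv : Fin k → ℝ, (∀ j, IsDyadic (Nv j)) → ∀ ζ : ℝ, ∀ nn : Fin 3 → ℤ,
          ∀ S : Set (Fin k → Fin 3 → ℤ),
            S = {n | (∀ j, SimFreq (Nv j) (n j)) ∧ nn = ∑ j, n j ∧
                  |phase α εsum ε n - ζ| ≤ 1} →
            S.Finite ∧
              (S.ncard : ℝ) ≤
                C * (sSup (Set.range Nv) ^ 3)⁻¹ * (thirdMax Nv)⁻¹ * ∏ j, Nv j ^ 3 := by
  classical
  obtain ⟨C, hC, htriple⟩ := exists_card_triple_le hα₁ hα₂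
  refine ⟨27 ^ k * C, by positivity, ?_⟩
  intro εsum _ ε hε Nv hNv ζ nn S hS
  choose e he using hNv
  set N : Fin k → ℕ := fun j => 2 ^ e j with hNdef
  have hNvN : Nv = fun j => (N j : ℝ) := by
    funext j
    rw [he j, hNdef]
    push_cast
    rfl
  subst hNvN
  have hN1 : ∀ j, 1 ≤ N j := fun j => Nat.one_le_two_pow
  obtain ⟨i₁, i₂, i₃, h12, h13, h23, h32, h21, hmax, hthird⟩ := exists_three_largest hk N
  rw [sSup_range_eq_of_forall_le (N := fun j => (N j : ℝ)) (i := i₁)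
      (fun j => by exact_mod_cast hmax j),
    thirdMax_eq (N := fun j => (N j : ℝ)) h12 h13 h23 (by exact_mod_cast h32)
      (by exact_mod_cast h21) (fun j hj1 hj2 => by exact_mod_cast hthird j hj1 hj2)]
  have hmem : ∀ n ∈ S, (∀ j, SimFreq (N j) (n j)) ∧ nn = ∑ j, n j ∧
      |phase α εsum ε n - ζ| ≤ 1 := fun n hn => by rw [hS] at hn; exact hn
  have hball : ∀ n ∈ S, ∀ j, n j ∈ latticeBox 0 (N j) := fun n hn j =>
    mem_latticeBox_of_norm_le (by simpa using ((hmem n hn).1 j).norm_le (hN1 j))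
  have hfin : S.Finite := by
    refine (Fintype.piFinset fun j => latticeBox 0 (N j)).finite_toSet.subset fun n hn => ?_
    exact Finset.mem_coe.2 (Fintype.mem_piFinset.2 (hball n hn))
  refine ⟨hfin, ?_⟩
  rw [Set.ncard_eq_toFinset_card S hfin]
  set I : Finset (Fin k) := {i₁, i₂, i₃} with hI
  let rest : (Fin k → Fin 3 → ℤ) → (Fin k → Fin 3 → ℤ) := fun n j => if j ∈ I then 0 else n j
  let code : (Fin k → Fin 3 → ℤ) → (Fin k → Fin 3 → ℤ) × ((Fin 3 → ℤ) × (Fin 3 → ℤ)) :=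
    fun n => (rest n, n i₂, n i₃)
  let box : Finset (Fin k → Fin 3 → ℤ) :=
    Fintype.piFinset fun j => if j ∈ I then {0} else latticeBox 0 (N j)
  have hrest : ∀ n, ∀ j ∈ Iᶜ, rest n j = n j := fun n j hj => if_neg (Finset.mem_compl.1 hj)
  have hfirst : ∀ n ∈ S, n i₁ = nn - ∑ j ∈ Iᶜ, rest n j - n i₂ - n i₃ := fun n hn => by
    rw [(hmem n hn).2.1, sum_eq_three_add_compl h12 h13 h23 n,
      Finset.sum_congr rfl (hrest n)]
    abel
  have hinj : Set.InjOn code (hfin.toFinset : Set (Fin k → Fin 3 → ℤ)) := by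
    intro n hn n' hn' hnn
    have hn : n ∈ S := by simpa using hn
    have hn' : n' ∈ S := by simpa using hn'
    simp only [code, Prod.mk.injEq] at hnn
    obtain ⟨hr, h2, h3⟩ := hnn
    funext j
    by_cases hj : j ∈ I
    · rw [hI, Finset.mem_insert, Finset.mem_insert, Finset.mem_singleton] at hj
      rcases hj with rfl | rfl | rfl
      · rw [hfirst n hn, hfirst n' hn', hr, h2, h3]
      · exact h2
      · exact h3
    · rw [← hrest n j (Finset.mem_compl.2 hj), hr, hrest n' j (Finset.mem_compl.2 hj)]
  have hbox : ∀ z ∈ hfin.toFinset.image code, z.1 ∈ box := by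
    intro z hz
    obtain ⟨n, hn, rfl⟩ := Finset.mem_image.1 hz
    refine Fintype.mem_piFinset.2 fun j => ?_
    by_cases hj : j ∈ I
    · simp [code, rest, hj]
    · simpa [code, rest, hj] using hball n (by simpa using hn) j
  have hsections := card_le_card_mul_of_sections
    (b := C * (N i₂ ^ 3 * N i₃ ^ 2)) (by positivity) hbox (fun y _ A hA => by
      obtain ⟨σ, hσ, hσR⟩ : ∃ σ : ℤ, (σ = 1 ∨ σ = -1) ∧ (σ : ℝ) = ε i₃ * ε i₁ := by
        rcases hε i₁ with h1 | h1 <;> rcases hε i₃ with h3 | h3 <;> rw [h1, h3]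
        · exact ⟨1, by simp⟩
        · exact ⟨-1, by simp⟩
        · exact ⟨-1, by simp⟩
        · exact ⟨1, by simp⟩
      refine htriple σ hσ A (nn - ∑ j ∈ Iᶜ, y j)
        (fun x => ε i₃ * (ζ - εsum * dispersion α (latticeEmb nn) -
          ε i₂ * dispersion α (latticeEmb x) - ∑ j ∈ Iᶜ, ε j * dispersion α (latticeEmb (y j))))
        (N i₁) (N i₂) (N i₃) (hN1 _) h32 h21 fun z hz => ?_
      obtain ⟨n, hn, hcode⟩ := Finset.mem_image.1 (hA z hz)
      have hn : n ∈ S := by simpa using hn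
      simp only [code, Prod.mk.injEq] at hcode
      obtain ⟨rfl, rfl⟩ := hcode
      obtain ⟨hsim, hsum, hphase⟩ := hmem n hn
      simp only
      rw [← hfirst n hn]
      refine ⟨(hsim i₂).norm_le (hN1 _), (hsim i₃).norm_le (hN1 _), (hsim i₁).norm_le (hN1 _),
        fun h => (hsim i₁).lt_norm h, ?_⟩
      have hrestsum : ∑ j ∈ Iᶜ, ε j * dispersion α (latticeEmb (rest n j)) =
          ∑ j ∈ Iᶜ, ε j * dispersion α (latticeEmb (n j)) :=
        Finset.sum_congr rfl fun j hj => by rw [hrest n j hj]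
      simp only [phase, jbb_eq_dispersion, ← hsum] at hphase
      rw [sum_eq_three_add_compl h12 h13 h23] at hphase
      rw [hrestsum, hσR]
      rcases hε i₃ with h3 | h3
      · rw [h3] at hphase ⊢
        refine le_of_eq_of_le (congrArg _ ?_) hphase
        ring
      · rw [h3] at hphase ⊢
        rw [← abs_neg]
        refine le_of_eq_of_le (congrArg _ ?_) hphase
        ring)
  rw [Finset.card_image_of_injOn hinj] at hsections
  have hboxcard : (box.card : ℝ) ≤ 27 ^ k * ∏ j ∈ Iᶜ, (N j : ℝ) ^ 3 := by
    have h1 : box.card ≤ 27 ^ k * ∏ j ∈ Iᶜ, N j ^ 3 := by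
      rw [Fintype.card_piFinset, ← Finset.prod_mul_prod_compl I,
        Finset.prod_eq_one (fun j hj => by rw [if_pos hj, Finset.card_singleton]), one_mul]
      calc _ ≤ ∏ j ∈ Iᶜ, 27 * N j ^ 3 := Finset.prod_le_prod' fun j hj => by
            rw [if_neg (Finset.mem_compl.1 hj)]
            exact card_latticeBox_le 0 (hN1 j)
        _ = 27 ^ Iᶜ.card * ∏ j ∈ Iᶜ, N j ^ 3 := by
            rw [Finset.prod_mul_distrib, Finset.prod_const]
        _ ≤ _ := by
            gcongr
            · norm_num
            · exact (Finset.card_le_univ _).trans (by simp)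
    exact_mod_cast h1
  rw [prod_eq_three_mul_compl h12 h13 h23]
  have hp1 : (N i₁ : ℝ) ≠ 0 := by exact_mod_cast Nat.one_le_iff_ne_zero.1 (hN1 i₁)
  have hp3 : (N i₃ : ℝ) ≠ 0 := by exact_mod_cast Nat.one_le_iff_ne_zero.1 (hN1 i₃)
  calc _ ≤ _ := hsections
    _ ≤ (27 ^ k * ∏ j ∈ Iᶜ, (N j : ℝ) ^ 3) * (C * (N i₂ ^ 3 * N i₃ ^ 2)) := by gcongr
    _ = _ := by
      rw [← hI]
      field_simp
end
end

section
/- Quintic counting estimate (Lemma 3.7): Let 1 < α ≤ 3/2 and s ≤ α − 1/2. For n_1, …, n_5 ∈ ℤ³ write n_123 = n_1+n_2+n_3 and n_12345 = n_1+⋯+n_5, and for fixed signs ε_123, ε_12345, ε_1, …, ε_5 ∈ {−1,+1} define κ_2(n_1,n_2,n_3) = ε_123·⟪n_123⟫ + ε_1·⟪n_1⟫ + ε_2·⟪n_2⟫ + ε_3·⟪n_3⟫, κ_3(n_1,…,n_5) = ε_12345·⟪n_12345⟫ + ε_123·⟪n_123⟫ + ε_4·⟪n_4⟫ + ε_5·⟪n_5⟫,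 and κ_4(n_1,…,n_5) = ε_12345·⟪n_12345⟫ + Σ_{j=1}^5 ε_j·⟪n_j⟫. Then there exist θ > 0 and C > 0, depending only on α and s (uniform in the sign choice), such that for all dyadic numbers N_1, …, N_5 ≥ 1 and all ζ, ζ′ ∈ ℝ, Σ_{n_1,…,n_5 ∈ ℤ³} [ (Π_{j=1}^5 1_{|n_j| ∼ N_j}) · ⟨n_12345⟩^{2(s−α)} · ⟪n_123⟫^{−2} · (Π_{j=1}^5 ⟪n_j⟫^{−2}) · 1_{|κ_2 − ζ| ≤ 1} · ( 1_{|κ_3 − ζ′| ≤ 1} + 1_{|κ_4 − ζ′| ≤ 1} ) ] ≤ C · N_max^{−θ}, where N_max = max(N_1, …, N_5). -/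
noncomputable section

open scoped BigOperators

/-- The Euclidean space in which the lattice `ℤ³` is embedded. -/
abbrev E3 : Type := EuclideanSpace ℝ (Fin 3)

/-- The embedding of `ℤ³` into Euclidean space. -/
def latE (n : Fin 3 → ℤ) : E3 := WithLp.toLp 2 (fun i => (n i : ℝ))

/-- The dispersion relation `(1 + |x|²)^{α/2}`. -/
def disp (α : ℝ) (x : E3) : ℝ := (1 + ‖x‖ ^ 2) ^ (α / 2)

/-- The convexity modulus of `disp α` on the ball of radius `R`. -/
def cvx (α R : ℝ) : ℝ := α * (α - 1) * (1 + R ^ 2) ^ (α / 2 - 1)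

/-- The Lipschitz constant of `disp α` on the ball of radius `R`. -/
def lip (α R : ℝ) : ℝ := α * (1 + R ^ 2) ^ ((α - 1) / 2)

lemma latE_apply (n : Fin 3 → ℤ) (i : Fin 3) : latE n i = n i := rfl

lemma latE_add (m n : Fin 3 → ℤ) : latE (m + n) = latE m + latE n := by
  ext i; simp [latE_apply]

lemma latE_neg (n : Fin 3 → ℤ) : latE (-n) = -latE n := by
  ext i; simp [latE_apply]

lemma norm_latE_sq (n : Fin 3 → ℤ) : ‖latE n‖ ^ 2 = ∑ i, ((n i : ℝ)) ^ 2 := by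
  rw [EuclideanSpace.norm_sq_eq]; simp [latE_apply]

lemma znorm_eq (n : Fin 3 → ℤ) : znorm n = ‖latE n‖ := by
  rw [znorm, ← norm_latE_sq, Real.sqrt_sq (norm_nonneg _)]

lemma jb_eq (n : Fin 3 → ℤ) : jb n = Real.sqrt (1 + ‖latE n‖ ^ 2) := by
  rw [jb, norm_latE_sq]

lemma one_le_jb (n : Fin 3 → ℤ) : 1 ≤ jb n := by
  rw [jb_eq, Real.one_le_sqrt]; nlinarith [sq_nonneg ‖latE n‖]

lemma norm_le_jb (n : Fin 3 → ℤ) : ‖latE n‖ ≤ jb n := by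
  rw [jb_eq]; apply Real.le_sqrt_of_sq_le; linarith

lemma jb_le (n : Fin 3 → ℤ) : jb n ≤ 1 + ‖latE n‖ := by
  rw [jb_eq, Real.sqrt_le_left (by positivity)]
  nlinarith [norm_nonneg (latE n)]

lemma jb_neg (n : Fin 3 → ℤ) : jb (-n) = jb n := by
  rw [jb_eq, jb_eq, latE_neg, norm_neg]

lemma jb_rpow (α : ℝ) (n : Fin 3 → ℤ) : jb n ^ α = disp α (latE n) := by
  rw [jb_eq, disp, Real.sqrt_eq_rpow, ← Real.rpow_mul (by positivity)]
  congr 1; ring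

lemma disp_neg (α : ℝ) (x : E3) : disp α (-x) = disp α x := by
  rw [disp, disp, norm_neg]

lemma jb_two_mul (α : ℝ) (n : Fin 3 → ℤ) : jb n ^ (2 * α) = (jb n ^ α) ^ 2 := by
  have := one_le_jb n
  rw [mul_comm, Real.rpow_mul (by linarith), Real.rpow_two]

lemma jbb_sq_ge (α : ℝ) (hα : 1 < α) (n : Fin 3 → ℤ) :
    3 / 4 * jb n ^ (2 * α) ≤ jbb α n ^ 2 := by
  have h : (1 : ℝ) ≤ jb n ^ (2 * α) := Real.one_le_rpow (one_le_jb n) (by linarith)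
  rw [jbb, Real.sq_sqrt (by linarith)]; linarith

lemma abs_jbb_sub_disp (α : ℝ) (hα : 1 < α) (n : Fin 3 → ℤ) :
    |jbb α n - disp α (latE n)| ≤ 1 / 4 := by
  have h : (1 : ℝ) ≤ jb n ^ α := Real.one_le_rpow (one_le_jb n) (by linarith)
  rw [← jb_rpow, jbb, jb_two_mul]
  set t := jb n ^ α
  have h1 : Real.sqrt (t ^ 2 - 1 / 4) ≤ t := by
    rw [Real.sqrt_le_left (by linarith)]; linarith
  have h2 : t - 1 / 4 ≤ Real.sqrt (t ^ 2 - 1 / 4) := by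
    apply Real.le_sqrt_of_sq_le; nlinarith
  rw [abs_le]; constructor <;> linarith

lemma cvx_nonneg {α : ℝ} (hα : 1 < α) (R : ℝ) : 0 ≤ cvx α R := by
  unfold cvx
  have : 0 ≤ α * (α - 1) := by nlinarith
  positivity

lemma one_le_lip {α : ℝ} (hα : 1 < α) (R : ℝ) : 1 ≤ lip α R := by
  unfold lip
  have : (1 : ℝ) ≤ (1 + R ^ 2) ^ ((α - 1) / 2) :=
    Real.one_le_rpow (by nlinarith) (by linarith)
  nlinarith

lemma lip_le {α R : ℝ} (hα : 1 < α) (hR : 1 ≤ R) :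
    (α - 1) * lip α R ≤ cvx α R * (2 * R) := by
  have h1 : (1 + R ^ 2) ^ ((α - 1) / 2) = (1 + R ^ 2) ^ (α / 2 - 1) * Real.sqrt (1 + R ^ 2) := by
    rw [Real.sqrt_eq_rpow, ← Real.rpow_add (by positivity)]; congr 1; ring
  have h2 : Real.sqrt (1 + R ^ 2) ≤ 2 * R := by
    rw [Real.sqrt_le_left (by linarith)]; nlinarith
  have h3 : (α - 1) * lip α R = cvx α R * Real.sqrt (1 + R ^ 2) := by
    rw [lip, cvx, h1]; ring
  rw [h3]
  exact mul_le_mul_of_nonneg_left h2 (cvx_nonneg hα R)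

lemma hasDerivAt_bracket_rpow (p r : ℝ) :
    HasDerivAt (fun r : ℝ => (1 + r ^ 2) ^ p) (2 * p * r * (1 + r ^ 2) ^ (p - 1)) r := by
  have h : HasDerivAt (fun r : ℝ => 1 + r ^ 2) (2 * r) r := by
    simpa using (hasDerivAt_pow 2 r).const_add 1
  convert h.rpow_const (p := p) (Or.inl (by positivity)) using 1
  ring

lemma hasDerivAt_convex_part (α μ r : ℝ) :
    HasDerivAt (fun r : ℝ => (1 + r ^ 2) ^ (α / 2) - μ / 2 * r ^ 2)
      (α * r * (1 + r ^ 2) ^ (α / 2 - 1) - μ * r) r := by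
  have h := (hasDerivAt_bracket_rpow (α / 2) r).sub ((hasDerivAt_pow 2 r).const_mul (μ / 2))
  refine h.congr_deriv ?_
  push_cast; ring

lemma hasDerivAt_convex_part_deriv (α μ r : ℝ) :
    HasDerivAt (fun r : ℝ => α * r * (1 + r ^ 2) ^ (α / 2 - 1) - μ * r)
      (α * (1 + r ^ 2) ^ (α / 2 - 1) +
        α * r * (2 * (α / 2 - 1) * r * (1 + r ^ 2) ^ (α / 2 - 1 - 1)) - μ) r := by
  have h := (((hasDerivAt_id r).const_mul α).mul
    (hasDerivAt_bracket_rpow (α / 2 - 1) r)).sub ((hasDerivAt_id r).const_mul μ)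
  refine h.congr_deriv ?_
  simp only [id]; ring

lemma convexOn_radial {α R : ℝ} (hα₁ : 1 < α) (hα₂ : α ≤ 2) :
    ConvexOn ℝ (Set.Icc 0 R) (fun r : ℝ => (1 + r ^ 2) ^ (α / 2) - cvx α R / 2 * r ^ 2) := by
  have hd : deriv (fun r : ℝ => (1 + r ^ 2) ^ (α / 2) - cvx α R / 2 * r ^ 2) =
      fun r : ℝ => α * r * (1 + r ^ 2) ^ (α / 2 - 1) - cvx α R * r :=
    funext fun r => (hasDerivAt_convex_part α _ r).deriv
  refine convexOn_of_deriv2_nonneg (convex_Icc 0 R) ?_ ?_ ?_ ?_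
  · exact fun r _ => (hasDerivAt_convex_part α _ r).continuousAt.continuousWithinAt
  · exact fun r _ => (hasDerivAt_convex_part α _ r).differentiableAt.differentiableWithinAt
  · rw [hd]
    exact fun r _ => (hasDerivAt_convex_part_deriv α _ r).differentiableAt.differentiableWithinAt
  · intro r hr
    rw [interior_Icc] at hr
    rw [Function.iterate_succ, Function.iterate_one, Function.comp_apply, hd,
      (hasDerivAt_convex_part_deriv α _ r).deriv]
    have h1 : (1 + r ^ 2) ^ (α / 2 - 1 - 1) = (1 + r ^ 2) ^ (α / 2 - 1) / (1 + r ^ 2) := by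
      rw [Real.rpow_sub_one (by positivity)]
    have h2 : (1 + R ^ 2) ^ (α / 2 - 1) ≤ (1 + r ^ 2) ^ (α / 2 - 1) :=
      Real.rpow_le_rpow_of_nonpos (by positivity) (by nlinarith [hr.1, hr.2]) (by linarith)
    have h0 : 0 ≤ (1 + R ^ 2) ^ (α / 2 - 1) := by positivity
    rw [h1, cvx]
    set X := (1 + r ^ 2) ^ (α / 2 - 1)
    have h3 : r * (r * (X / (1 + r ^ 2))) ≤ X := by
      have : r * (r * (X / (1 + r ^ 2))) = X * (r ^ 2 / (1 + r ^ 2)) := by ring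
      rw [this]
      apply mul_le_of_le_one_right (h0.trans h2)
      rw [div_le_one (by positivity)]; linarith
    have h4 : 0 ≤ α * (2 - α) := by nlinarith
    have h5 : 0 ≤ α * (α - 1) := by nlinarith
    nlinarith [mul_le_mul_of_nonneg_left h3 h4, mul_le_mul_of_nonneg_left h2 h5]

lemma monotoneOn_radial {α R : ℝ} (hα₁ : 1 < α) (hα₂ : α ≤ 2) :
    MonotoneOn (fun r : ℝ => (1 + r ^ 2) ^ (α / 2) - cvx α R / 2 * r ^ 2) (Set.Icc 0 R) := by
  refine monotoneOn_of_deriv_nonneg (convex_Icc 0 R) ?_ ?_ ?_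
  · exact fun r _ => (hasDerivAt_convex_part α _ r).continuousAt.continuousWithinAt
  · exact fun r _ => (hasDerivAt_convex_part α _ r).differentiableAt.differentiableWithinAt
  · intro r hr
    rw [interior_Icc] at hr
    rw [(hasDerivAt_convex_part α _ r).deriv, cvx]
    have h2 : (1 + R ^ 2) ^ (α / 2 - 1) ≤ (1 + r ^ 2) ^ (α / 2 - 1) :=
      Real.rpow_le_rpow_of_nonpos (by positivity) (by nlinarith [hr.1, hr.2]) (by linarith)
    have h0 : 0 ≤ (1 + R ^ 2) ^ (α / 2 - 1) := by positivity
    set X := (1 + r ^ 2) ^ (α / 2 - 1)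
    set Z := (1 + R ^ 2) ^ (α / 2 - 1)
    have h3 : (α - 1) * Z ≤ X := by nlinarith
    have h4 : 0 ≤ α * r := mul_nonneg (by linarith) hr.1.le
    nlinarith [mul_le_mul_of_nonneg_left h3 h4]

lemma convexOn_disp {α R : ℝ} (hα₁ : 1 < α) (hα₂ : α ≤ 2) :
    ConvexOn ℝ (Metric.closedBall (0 : E3) R)
      (fun x => disp α x - cvx α R / 2 * ‖x‖ ^ 2) := by
  refine ⟨convex_closedBall 0 R, fun x hx y hy p q hp hq hpq => ?_⟩
  have hxy := convex_closedBall (0 : E3) R hx hy hp hq hpq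
  rw [mem_closedBall_zero_iff] at hx hy hxy
  have h1 : ‖p • x + q • y‖ ≤ p * ‖x‖ + q * ‖y‖ := by
    refine (norm_add_le _ _).trans_eq ?_
    rw [norm_smul, norm_smul, Real.norm_of_nonneg hp, Real.norm_of_nonneg hq]
  have hX : ‖x‖ ∈ Set.Icc 0 R := ⟨norm_nonneg _, hx⟩
  have hY : ‖y‖ ∈ Set.Icc 0 R := ⟨norm_nonneg _, hy⟩
  have hc := (convex_Icc 0 R) hX hY hp hq hpq
  simp only [smul_eq_mul] at hc
  refine (monotoneOn_radial hα₁ hα₂ ⟨norm_nonneg _, hxy⟩ hc h1).trans ?_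
  exact (convexOn_radial hα₁ hα₂).2 hX hY hp hq hpq

lemma disp_lipschitz {α R : ℝ} (hα : 1 < α) {x y : E3} (hx : ‖x‖ ≤ R) (hy : ‖y‖ ≤ R) :
    |disp α x - disp α y| ≤ lip α R * ‖x - y‖ := by
  have h := Convex.norm_image_sub_le_of_norm_hasDerivWithin_le
    (f := fun r : ℝ => (1 + r ^ 2) ^ (α / 2))
    (f' := fun r => 2 * (α / 2) * r * (1 + r ^ 2) ^ (α / 2 - 1))
    (C := lip α R) (s := Set.Icc 0 R) (x := ‖y‖) (y := ‖x‖)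
    (fun r _ => (hasDerivAt_bracket_rpow (α / 2) r).hasDerivWithinAt) ?_ (convex_Icc 0 R)
    ⟨norm_nonneg _, hy⟩ ⟨norm_nonneg _, hx⟩
  · have h' : |disp α x - disp α y| ≤ lip α R * |‖x‖ - ‖y‖| := h
    refine h'.trans (mul_le_mul_of_nonneg_left (abs_norm_sub_norm_le x y) ?_)
    linarith [one_le_lip hα R]
  · intro r hr
    have hr0 : 0 ≤ 2 * (α / 2) * r * (1 + r ^ 2) ^ (α / 2 - 1) := by
      have := hr.1
      have : 0 ≤ α := by linarith
      positivity
    rw [Real.norm_of_nonneg hr0, lip]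
    have h1 : r ≤ (1 + r ^ 2) ^ (1 / 2 : ℝ) := by
      rw [← Real.sqrt_eq_rpow]; apply Real.le_sqrt_of_sq_le; linarith
    have h2 : (1 + r ^ 2) ^ (1 / 2 : ℝ) * (1 + r ^ 2) ^ (α / 2 - 1) =
        (1 + r ^ 2) ^ ((α - 1) / 2) := by
      rw [← Real.rpow_add (by positivity)]; congr 1; ring
    have h3 : (1 + r ^ 2) ^ ((α - 1) / 2) ≤ (1 + R ^ 2) ^ ((α - 1) / 2) :=
      Real.rpow_le_rpow (by positivity) (by nlinarith [hr.1, hr.2]) (by linarith)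
    have h4 : r * (1 + r ^ 2) ^ (α / 2 - 1) ≤ (1 + R ^ 2) ^ ((α - 1) / 2) := by
      refine le_trans ?_ (h2.le.trans h3)
      exact mul_le_mul_of_nonneg_right h1 (by positivity)
    nlinarith

/-- Increments of `disp α` in the direction `a` grow at least linearly along `a`. -/
lemma disp_increment_growth {α R s : ℝ} (hα₁ : 1 < α) (hα₂ : α ≤ 2) (hs : 0 ≤ s) {x a : E3}
    (h0 : ‖x‖ ≤ R) (h1 : ‖x + (1 + s) • a‖ ≤ R) :
    disp α (x + a) - disp α x + cvx α R * s * ‖a‖ ^ 2 ≤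
      disp α (x + (1 + s) • a) - disp α (x + s • a) := by
  have hs1 : (1 + s) ≠ 0 := by positivity
  have hc := convexOn_disp (R := R) hα₁ hα₂
  have m0 : x ∈ Metric.closedBall (0 : E3) R := by simpa using h0
  have m1 : x + (1 + s) • a ∈ Metric.closedBall (0 : E3) R := by
    rw [mem_closedBall_zero_iff]; exact h1
  have e : s / (1 + s) + 1 / (1 + s) = 1 := by field_simp; ring
  have c1 := hc.2 m0 m1 (by positivity : 0 ≤ s / (1 + s)) (by positivity : 0 ≤ 1 / (1 + s)) e
  have c2 := hc.2 m0 m1 (by positivity : 0 ≤ 1 / (1 + s)) (by positivity : 0 ≤ s / (1 + s))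
    ((add_comm _ _).trans e)
  have p1 : (s / (1 + s)) • x + (1 / (1 + s)) • (x + (1 + s) • a) = x + a := by
    rw [smul_add, ← add_assoc, ← add_smul, e, smul_smul, one_div_mul_cancel hs1, one_smul, one_smul]
  have p2 : (1 / (1 + s)) • x + (s / (1 + s)) • (x + (1 + s) • a) = x + s • a := by
    rw [smul_add, ← add_assoc, ← add_smul, add_comm (1 / (1 + s)), e, smul_smul,
      div_mul_cancel₀ _ hs1, one_smul]
  rw [p1] at c1
  rw [p2] at c2
  simp only [smul_eq_mul] at c1 c2
  have n1 : ‖x + a‖ ^ 2 = ‖x‖ ^ 2 + 2 * inner ℝ x a + ‖a‖ ^ 2 := norm_add_sq_real x a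
  have n2 : ‖x + s • a‖ ^ 2 = ‖x‖ ^ 2 + 2 * (s * inner ℝ x a) + s ^ 2 * ‖a‖ ^ 2 := by
    rw [norm_add_sq_real, inner_smul_right, norm_smul, mul_pow, Real.norm_eq_abs, sq_abs]
  have n3 : ‖x + (1 + s) • a‖ ^ 2 =
      ‖x‖ ^ 2 + 2 * ((1 + s) * inner ℝ x a) + (1 + s) ^ 2 * ‖a‖ ^ 2 := by
    rw [norm_add_sq_real, inner_smul_right, norm_smul, mul_pow, Real.norm_eq_abs, sq_abs]
  set A := disp α x - cvx α R / 2 * ‖x‖ ^ 2 with hA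
  set B := disp α (x + (1 + s) • a) - cvx α R / 2 * ‖x + (1 + s) • a‖ ^ 2 with hB
  have hsum : (s / (1 + s) * A + 1 / (1 + s) * B) + (1 / (1 + s) * A + s / (1 + s) * B) = A + B := by
    field_simp; ring
  rw [n3] at hB
  rw [n1] at c1
  rw [n2] at c2
  nlinarith [c1, c2, hsum]

/-- The sum of two translates of `disp α`, symmetric about the origin, grows quadratically
under dilation. -/
lemma disp_dilation_growth {α R l : ℝ} (hα₁ : 1 < α) (hα₂ : α ≤ 2) (hl : 1 ≤ l) {y b : E3}
    (h0 : ‖l • y + b‖ ≤ R) (h1 : ‖l • y - b‖ ≤ R) :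
    disp α (y + b) + disp α (y - b) + cvx α R * (l ^ 2 - 1) * ‖y‖ ^ 2 ≤
      disp α (l • y + b) + disp α (l • y - b) := by
  have hl0 : l ≠ 0 := by positivity
  have hc := convexOn_disp (R := R) hα₁ hα₂
  have m0 : l • y + b ∈ Metric.closedBall (0 : E3) R := by
    rw [mem_closedBall_zero_iff]; exact h0
  have m1 : l • y - b ∈ Metric.closedBall (0 : E3) R := by
    rw [mem_closedBall_zero_iff]; exact h1
  have m0' : -(l • y + b) ∈ Metric.closedBall (0 : E3) R := by
    rw [mem_closedBall_zero_iff, norm_neg]; exact h0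
  have m1' : -(l • y - b) ∈ Metric.closedBall (0 : E3) R := by
    rw [mem_closedBall_zero_iff, norm_neg]; exact h1
  have hinv : 1 / l ≤ 1 := by rw [div_le_one (by positivity)]; exact hl
  have hp : 0 ≤ (1 + 1 / l) / 2 := by positivity
  have hq : 0 ≤ (1 - 1 / l) / 2 := by linarith
  have e : (1 + 1 / l) / 2 + (1 - 1 / l) / 2 = 1 := by ring
  have c1 := hc.2 m0 m1' hp hq e
  have c2 := hc.2 m1 m0' hp hq e
  have p1 : ((1 + 1 / l) / 2) • (l • y + b) + ((1 - 1 / l) / 2) • -(l • y - b) = y + b := by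
    ext i; simp; field_simp; ring
  have p2 : ((1 + 1 / l) / 2) • (l • y - b) + ((1 - 1 / l) / 2) • -(l • y + b) = y - b := by
    ext i; simp; field_simp; ring
  rw [p1] at c1
  rw [p2] at c2
  simp only [smul_eq_mul, disp_neg, norm_neg] at c1 c2
  have n1 := parallelogram_law_with_norm ℝ y b
  have n2 := parallelogram_law_with_norm ℝ (l • y) b
  have n3 : ‖l • y‖ * ‖l • y‖ = l ^ 2 * ‖y‖ ^ 2 := by
    rw [norm_smul, Real.norm_eq_abs, ← sq_abs l]; ring
  set A := disp α (l • y + b) - cvx α R / 2 * ‖l • y + b‖ ^ 2 with hA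
  set B := disp α (l • y - b) - cvx α R / 2 * ‖l • y - b‖ ^ 2 with hB
  have hsum : ((1 + 1 / l) / 2 * A + (1 - 1 / l) / 2 * B) +
      ((1 + 1 / l) / 2 * B + (1 - 1 / l) / 2 * A) = A + B := by ring
  have n4 : ‖l • y + b‖ ^ 2 + ‖l • y - b‖ ^ 2 - ‖y + b‖ ^ 2 - ‖y - b‖ ^ 2 =
      2 * (l ^ 2 - 1) * ‖y‖ ^ 2 := by nlinarith
  have n5 : cvx α R / 2 * (‖l • y + b‖ ^ 2 + ‖l • y - b‖ ^ 2 - ‖y + b‖ ^ 2 - ‖y - b‖ ^ 2) =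
      cvx α R * (l ^ 2 - 1) * ‖y‖ ^ 2 := by rw [n4]; ring
  linarith

/-- A finite set of lattice points containing all those at distance at most `r` from `c`. -/
def boxAt (c : E3) (r : ℝ) : Finset (Fin 3 → ℤ) :=
  Finset.Icc (fun i => ⌈c i - r⌉) (fun i => ⌊c i + r⌋)

lemma abs_apply_le_norm (x : E3) (i : Fin 3) : |x i| ≤ ‖x‖ := by
  rw [← Real.norm_eq_abs]; exact PiLp.norm_apply_le x i

lemma mem_boxAt {c : E3} {r : ℝ} {n : Fin 3 → ℤ} (h : ‖latE n - c‖ ≤ r) : n ∈ boxAt c r := by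
  rw [boxAt, Finset.mem_Icc]
  have h' : ∀ i, |(n i : ℝ) - c i| ≤ r := fun i => (abs_apply_le_norm (latE n - c) i).trans h
  constructor <;> intro i
  · exact Int.ceil_le.2 (by linarith [(abs_le.1 (h' i)).1])
  · exact Int.le_floor.2 (by linarith [(abs_le.1 (h' i)).2])

lemma card_boxAt_le {c : E3} {r : ℝ} (hr : 1 ≤ r) : ((boxAt c r).card : ℝ) ≤ 27 * r ^ 3 := by
  rw [boxAt, Pi.card_Icc]
  push_cast
  have h : ∀ i ∈ Finset.univ,
      ((Finset.Icc ⌈c i - r⌉ ⌊c i + r⌋).card : ℝ) ≤ 3 * r := by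
    intro i _
    rw [Int.card_Icc]
    have h1 := Int.floor_le (c i + r)
    have h2 := Int.le_ceil (c i - r)
    have h3 : (((⌊c i + r⌋ + 1 - ⌈c i - r⌉).toNat : ℤ) : ℝ) ≤ 3 * r := by
      rw [Int.toNat_eq_max]
      push_cast
      exact max_le (by linarith) (by linarith)
    exact_mod_cast h3
  refine (Finset.prod_le_prod (fun _ _ => by positivity) h).trans_eq ?_
  simp; ring

lemma card_le_of_norm_sub_le {c : E3} {r : ℝ} (hr : 1 ≤ r) {S : Finset (Fin 3 → ℤ)}
    (hS : ∀ k ∈ S, ‖latE k - c‖ ≤ r) : (S.card : ℝ) ≤ 27 * r ^ 3 := by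
  refine le_trans ?_ (card_boxAt_le (c := c) hr)
  exact_mod_cast Finset.card_le_card fun k hk => mem_boxAt (hS k hk)

/-- Coordinatewise integer part. -/
def floorE (x : E3) : Fin 3 → ℤ := fun i => ⌊x i⌋

lemma norm_le_two_of_abs_le_one {x : E3} (h : ∀ i, |x i| ≤ 1) : ‖x‖ ≤ 2 := by
  have h2 : ‖x‖ ^ 2 ≤ 3 := by
    rw [EuclideanSpace.norm_sq_eq, Fin.sum_univ_three]
    have h' : ∀ i, ‖x i‖ ^ 2 ≤ 1 := fun i => by
      rw [Real.norm_eq_abs, sq_abs]; exact (sq_le_one_iff_abs_le_one _).2 (h i)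
    linarith [h' 0, h' 1, h' 2]
  nlinarith [norm_nonneg x]

lemma norm_floorE_sub_le (x : E3) : ‖latE (floorE x) - x‖ ≤ 2 := by
  refine norm_le_two_of_abs_le_one fun i => ?_
  change |((⌊x i⌋ : ℤ) : ℝ) - x i| ≤ 1
  rw [abs_le]
  constructor <;> linarith [Int.floor_le (x i), Int.lt_floor_add_one (x i)]

lemma abs_sub_lt_one_of_floorE_eq {x y : E3} (h : floorE x = floorE y) (i : Fin 3) :
    |x i - y i| < 1 :=
  Int.abs_sub_lt_one_of_floor_eq_floor (congrFun h i)

/-- If the images of `S` under `J` expanding affine maps are separated and stay near lattice points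
of `B`, then `B` has at least `J * #S` elements. -/
lemma card_packing {S B : Finset (Fin 3 → ℤ)} {J : ℕ} {l : ℕ → ℝ} {c : ℕ → E3}
    (hl : ∀ j, 1 ≤ l j)
    (hB : ∀ j < J, ∀ k ∈ S, ∀ n, ‖latE n - (l j • latE k + c j)‖ ≤ 2 → n ∈ B)
    (hsep : ∀ j < J, ∀ j' < j, ∀ k ∈ S, ∀ k' ∈ S,
      ¬ ‖(l j • latE k + c j) - (l j' • latE k' + c j')‖ ≤ 2) :
    J * S.card ≤ B.card := by
  have h := Finset.card_le_card_of_injOn (s := Finset.range J ×ˢ S) (t := B)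
    (fun p => floorE (l p.1 • latE p.2 + c p.1)) ?_ ?_
  · simpa using h
  · rintro ⟨j, k⟩ hjk
    simp only [Finset.coe_product, Finset.coe_range, Set.mem_prod, Set.mem_Iio,
      Finset.mem_coe] at hjk
    exact hB j hjk.1 k hjk.2 _ (norm_floorE_sub_le _)
  · rintro ⟨j, k⟩ hjk ⟨j', k'⟩ hjk' heq
    simp only [Finset.coe_product, Finset.coe_range, Set.mem_prod, Set.mem_Iio,
      Finset.mem_coe] at hjk hjk' heq
    have hlt := abs_sub_lt_one_of_floorE_eq heq
    have hle : ‖(l j • latE k + c j) - (l j' • latE k' + c j')‖ ≤ 2 :=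
      norm_le_two_of_abs_le_one fun i => (hlt i).le
    rcases lt_trichotomy j j' with h | h | h
    · rw [norm_sub_rev] at hle
      exact absurd hle (hsep j' hjk'.1 j h k' hjk'.2 k hjk.2)
    · subst h
      refine Prod.ext rfl (funext fun i => ?_)
      have h1 := hlt i
      simp only [PiLp.add_apply, PiLp.smul_apply, latE_apply, smul_eq_mul,
        add_sub_add_right_eq_sub] at h1
      rw [← mul_sub, abs_mul, abs_of_pos (by linarith [hl j])] at h1
      have h2 : |(k i : ℝ) - k' i| < 1 :=
        lt_of_le_of_lt (le_mul_of_one_le_left (abs_nonneg _) (hl j)) h1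
      have h3 : |k i - k' i| < 1 := by exact_mod_cast h2
      have h4 := Int.abs_lt_one_iff.1 h3
      change k i = k' i
      omega
    · exact absurd hle (hsep j hjk.1 j' h k hjk.2 k' hjk'.2)

lemma card_le_of_packing {N J M t : ℝ} (hN : 0 ≤ N) (ht : 0 < t) (hJ : t ≤ J) (h : J * N ≤ M) :
    N ≤ M / t := by
  rw [le_div_iff₀ ht]; nlinarith

/-- Counting lattice points in a slab of the difference phase. -/
lemma card_difference_phase {α K ζ : ℝ} (hα₁ : 1 < α) (hα₂ : α ≤ 2) (hK : 1 ≤ K)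
    {a : Fin 3 → ℤ} (ha : 0 < ‖latE a‖) {S : Finset (Fin 3 → ℤ)}
    (hS : ∀ k ∈ S, ‖latE k‖ ≤ K ∧
      |disp α (latE k + latE a) - disp α (latE k) - ζ| ≤ 3 / 2) :
    (S.card : ℝ) ≤ 150000 / (α - 1) * K ^ 2 * ((K + ‖latE a‖ + 1) / ‖latE a‖) := by
  set A := ‖latE a‖ with hA
  have hα' : 0 < α - 1 := by linarith
  set R := 2 * K + A + 1 with hR
  have hR1 : 1 ≤ R := by linarith
  set σ := 16 * R / ((α - 1) * A ^ 2) with hσ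
  have hσ0 : 0 < σ := by positivity
  have hgrow : 8 * lip α R ≤ cvx α R * σ * A ^ 2 := by
    have h1 : cvx α R * σ * A ^ 2 = 8 * (cvx α R * (2 * R) / (α - 1)) := by
      rw [hσ]; field_simp; ring
    rw [h1]
    refine mul_le_mul_of_nonneg_left ?_ (by norm_num)
    rw [le_div_iff₀ hα', mul_comm]
    exact lip_le hα₁ hR1
  have hL := one_le_lip hα₁ R
  set J := ⌊K / (σ * A)⌋₊ + 1 with hJ
  have hj : ∀ j < J, (j : ℝ) * σ * A ≤ K := by
    intro j hj
    have h1 : (j : ℝ) ≤ K / (σ * A) :=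
      (Nat.cast_le.2 (Nat.lt_succ_iff.1 hj)).trans (Nat.floor_le (by positivity))
    rw [le_div_iff₀ (by positivity)] at h1
    linarith
  have hpack := card_packing (S := S) (B := boxAt 0 (2 * K + 2)) (J := J) (l := fun _ => 1)
    (c := fun j => ((j : ℝ) * σ) • latE a) (fun _ => le_rfl) ?_ ?_
  · have h1 : (J : ℝ) * S.card ≤ 27 * (2 * K + 2) ^ 3 := by
      refine le_trans ?_ (card_boxAt_le (c := 0) (by linarith : (1 : ℝ) ≤ 2 * K + 2))
      exact_mod_cast hpack
    have h2 : K / (σ * A) ≤ J := by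
      rw [hJ]; push_cast; exact (Nat.lt_floor_add_one _).le
    have h3 := card_le_of_packing (by positivity) (by positivity) h2 h1
    refine h3.trans ?_
    have h4 : 27 * (2 * K + 2) ^ 3 ≤ 27 * (4 * K) ^ 3 := by gcongr; linarith
    calc 27 * (2 * K + 2) ^ 3 / (K / (σ * A)) ≤ 27 * (4 * K) ^ 3 / (K / (σ * A)) := by gcongr
      _ = 27648 / (α - 1) * K ^ 2 * (R / A) := by rw [hσ]; field_simp; ring
      _ ≤ 27648 / (α - 1) * K ^ 2 * (2 * (K + A + 1) / A) := by gcongr; linarith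
      _ = 55296 / (α - 1) * K ^ 2 * ((K + A + 1) / A) := by ring
      _ ≤ _ := by gcongr; norm_num
  · intro j hjJ k hk n hn
    refine mem_boxAt ?_
    rw [sub_zero]
    have h1 := hj j hjJ
    rw [one_smul] at hn
    have h2 : ‖((j : ℝ) * σ) • latE a‖ ≤ K := by
      rw [norm_smul, Real.norm_of_nonneg (by positivity)]; exact h1
    have h3 : latE n = (latE n - (latE k + ((j : ℝ) * σ) • latE a)) +
      (latE k + ((j : ℝ) * σ) • latE a) := by abel
    rw [h3]
    refine (norm_add_le _ _).trans ?_
    have h4 := norm_add_le (latE k) (((j : ℝ) * σ) • latE a)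
    linarith [(hS k hk).1]
  · intro j hjJ j' hj' k hk k' hk' hle
    set s := ((j : ℝ) - j') * σ with hs
    have hjj : (1 : ℝ) ≤ (j : ℝ) - j' := by
      have : (j' : ℝ) + 1 ≤ j := by exact_mod_cast hj'
      linarith
    have hσs : σ ≤ s := by rw [hs]; nlinarith
    have hsA : s * A ≤ K := by
      refine le_trans ?_ (hj j hjJ)
      rw [hs]
      have : (0 : ℝ) ≤ j' := by positivity
      gcongr; linarith
    have hle' : ‖(latE k + s • latE a) - latE k'‖ ≤ 2 := by
      convert hle using 2
      simp only [one_smul, hs, sub_mul, sub_smul]; abel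
    obtain ⟨hkK, hkw⟩ := hS k hk
    obtain ⟨hkK', hkw'⟩ := hS k' hk'
    have hsa : ‖s • latE a‖ = s * A := by
      rw [norm_smul, Real.norm_of_nonneg (by linarith)]
    have e1 : latE k + (1 + s) • latE a = latE k + s • latE a + latE a := by
      rw [add_smul, one_smul]; abel
    have n1 : ‖latE k + s • latE a‖ ≤ 2 * K := by
      refine (norm_add_le _ _).trans ?_; rw [hsa]; linarith
    have n2 : ‖latE k + (1 + s) • latE a‖ ≤ R := by
      rw [e1]; refine (norm_add_le _ _).trans ?_; linarith
    have n3 : ‖latE k' + latE a‖ ≤ R := by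
      refine (norm_add_le _ _).trans ?_; linarith
    have g := disp_increment_growth (R := R) hα₁ hα₂ (by linarith : 0 ≤ s)
      (by linarith : ‖latE k‖ ≤ R) n2
    have l1 := disp_lipschitz (R := R) hα₁ n2 n3
    have l2 := disp_lipschitz (R := R) hα₁ (by linarith : ‖latE k + s • latE a‖ ≤ R)
      (by linarith : ‖latE k'‖ ≤ R)
    rw [show latE k + (1 + s) • latE a - (latE k' + latE a) =
      latE k + s • latE a - latE k' by rw [e1]; abel] at l1
    have l3 : lip α R * ‖latE k + s • latE a - latE k'‖ ≤ lip α R * 2 :=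
      mul_le_mul_of_nonneg_left hle' (by linarith)
    have g2 : cvx α R * σ * A ^ 2 ≤ cvx α R * s * A ^ 2 := by
      have := cvx_nonneg hα₁ R
      gcongr
    rw [abs_le] at hkw hkw' l1 l2
    linarith [hkw.1, hkw.2, hkw'.1, hkw'.2, l1.1, l1.2, l2.1, l2.2]

set_option maxHeartbeats 1000000 in
/-- Counting lattice points in a slab of the sum phase, at a fixed distance scale `Y` from the
centre of symmetry `-a/2`. -/
lemma card_sum_phase_shell {α K Y ζ : ℝ} (hα₁ : 1 < α) (hα₂ : α ≤ 2) (hK : 1 ≤ K) (hY : 1 ≤ Y)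
    {a : Fin 3 → ℤ} {S : Finset (Fin 3 → ℤ)}
    (hS : ∀ k ∈ S, ‖latE k‖ ≤ K ∧
      |disp α (latE k + latE a) + disp α (latE k) - ζ| ≤ 3 / 2)
    (hSY : ∀ k ∈ S, Y / 4 ≤ ‖latE k + (1 / 2 : ℝ) • latE a‖ ∧
      ‖latE k + (1 / 2 : ℝ) • latE a‖ ≤ Y) :
    (S.card : ℝ) ≤ 2000000 / (α - 1) * (min K Y) ^ 2 * ((K + ‖latE a‖) / Y) := by
  set A := ‖latE a‖ with hA
  have hA0 : 0 ≤ A := norm_nonneg _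
  set b : E3 := (1 / 2 : ℝ) • latE a with hb
  have hbA : ‖b‖ = A / 2 := by
    rw [hb, norm_smul, Real.norm_of_nonneg (by norm_num)]; ring
  have hα' : 0 < α - 1 := by linarith
  set R := 2 * K + 2 * A + 2 with hR
  have hR1 : 1 ≤ R := by linarith
  set M := min K Y with hM
  have hM1 : 1 ≤ M := le_min hK hY
  have hMK : M ≤ K := min_le_left _ _
  have hMY : M ≤ Y := min_le_right _ _
  set η := 256 * R / ((α - 1) * Y ^ 2) with hη
  have hη0 : 0 < η := by positivity
  have hgrow : 8 * lip α R ≤ cvx α R * η * (Y / 4) ^ 2 := by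
    have h1 : cvx α R * η * (Y / 4) ^ 2 = 8 * (cvx α R * (2 * R) / (α - 1)) := by
      rw [hη]; field_simp; ring
    rw [h1]
    refine mul_le_mul_of_nonneg_left ?_ (by norm_num)
    rw [le_div_iff₀ hα', mul_comm]
    exact lip_le hα₁ hR1
  have hL := one_le_lip hα₁ R
  set δ := M / Y with hδ
  have hδ1 : δ ≤ 1 := by rw [hδ, div_le_one (by linarith)]; exact hMY
  have hδY : δ * Y = M := by rw [hδ]; field_simp
  set J := ⌊δ / η⌋₊ + 1 with hJ
  have hj : ∀ j < J, (j : ℝ) * η ≤ δ := by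
    intro j hj
    have h1 : (j : ℝ) ≤ δ / η :=
      (Nat.cast_le.2 (Nat.lt_succ_iff.1 hj)).trans (Nat.floor_le (by positivity))
    rwa [le_div_iff₀ (by positivity)] at h1
  have hpt : ∀ (j : ℕ) (k : Fin 3 → ℤ), (1 + (j : ℝ) * η) • latE k + ((j : ℝ) * η) • b =
      (1 + (j : ℝ) * η) • (latE k + b) - b := by
    intro j k
    rw [smul_add, add_smul 1 ((j : ℝ) * η) b, one_smul]; abel
  set c : E3 := if K ≤ Y then 0 else -b with hc
  have hpack := card_packing (S := S) (B := boxAt c (2 * M + 2)) (J := J)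
    (l := fun j => 1 + (j : ℝ) * η)
    (c := fun j => ((j : ℝ) * η) • b) (fun j => by
      have : 0 ≤ (j : ℝ) * η := by positivity
      linarith) ?_ ?_
  · have h1 : (J : ℝ) * S.card ≤ 27 * (2 * M + 2) ^ 3 := by
      refine le_trans ?_ (card_boxAt_le (c := c) (by linarith : (1 : ℝ) ≤ 2 * M + 2))
      exact_mod_cast hpack
    have h2 : δ / η ≤ J := by
      rw [hJ]; push_cast; exact (Nat.lt_floor_add_one _).le
    have h3 := card_le_of_packing (by positivity) (by positivity) h2 h1
    refine h3.trans ?_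
    calc 27 * (2 * M + 2) ^ 3 / (δ / η) ≤ 27 * (4 * M) ^ 3 / (δ / η) := by gcongr; linarith
      _ = 442368 / (α - 1) * M ^ 2 * (R / Y) := by rw [hη, hδ]; field_simp; ring
      _ ≤ 442368 / (α - 1) * M ^ 2 * (4 * (K + A) / Y) := by gcongr; linarith
      _ = 1769472 / (α - 1) * M ^ 2 * ((K + A) / Y) := by ring
      _ ≤ _ := by gcongr; norm_num
  · intro j hjJ k hk n hn
    refine mem_boxAt ?_
    have h1 := hj j hjJ
    simp only [hpt] at hn
    have hk1 := (hSY k hk).2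
    have h5 : ‖((j : ℝ) * η) • (latE k + b)‖ ≤ M := by
      rw [norm_smul, Real.norm_of_nonneg (by positivity), ← hδY]
      gcongr
    rw [hc]
    split_ifs with hKY
    · have h3 : latE n - 0 = (latE n - ((1 + (j : ℝ) * η) • (latE k + b) - b)) +
        (latE k + ((j : ℝ) * η) • (latE k + b)) := by
        rw [add_smul 1 ((j : ℝ) * η), one_smul]; abel
      rw [h3]
      refine (norm_add_le _ _).trans ?_
      have h4 := norm_add_le (latE k) (((j : ℝ) * η) • (latE k + b))
      have h6 : M = K := min_eq_left hKY
      linarith [(hS k hk).1]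
    · have h3 : latE n - -b = (latE n - ((1 + (j : ℝ) * η) • (latE k + b) - b)) +
        ((latE k + b) + ((j : ℝ) * η) • (latE k + b)) := by
        rw [add_smul 1 ((j : ℝ) * η), one_smul]; abel
      rw [h3]
      refine (norm_add_le _ _).trans ?_
      have h4 := norm_add_le (latE k + b) (((j : ℝ) * η) • (latE k + b))
      have h6 : M = Y := min_eq_right (le_of_not_ge hKY)
      linarith
  · intro j hjJ j' hj' k hk k' hk' hle
    simp only [hpt, sub_sub_sub_cancel_right] at hle
    have hjj : (1 : ℝ) ≤ (j : ℝ) - j' := by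
      have : (j' : ℝ) + 1 ≤ j := by exact_mod_cast hj'
      linarith
    have h1 := hj j hjJ
    have hl'0 : 0 ≤ (j' : ℝ) * η := by positivity
    have hlj' : (j' : ℝ) * η + η ≤ (j : ℝ) * η := by nlinarith
    set lj := 1 + (j : ℝ) * η with hlj
    set lj' := 1 + (j' : ℝ) * η with hlj'
    have hp' : 0 < lj' := by linarith
    set l := lj / lj' with hl
    have hl1 : 1 + η / 2 ≤ l := by
      rw [hl, le_div_iff₀ hp']; nlinarith
    have hl2 : l ≤ 2 := by
      rw [hl, div_le_iff₀ hp']; nlinarith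
    have hlsq : η ≤ l ^ 2 - 1 := by nlinarith
    set y := latE k + b with hy
    set y' := latE k' + b with hy'
    have hle' : ‖l • y - y'‖ ≤ 2 := by
      have e : lj • y - lj' • y' = lj' • (l • y - y') := by
        rw [smul_sub, smul_smul, hl, mul_div_cancel₀ _ hp'.ne']
      rw [e, norm_smul, Real.norm_of_nonneg hp'.le] at hle
      nlinarith [norm_nonneg (l • y - y')]
    obtain ⟨hkK, hkw⟩ := hS k hk
    obtain ⟨hkK', hkw'⟩ := hS k' hk'
    obtain ⟨hy1, hy2⟩ := hSY k hk
    have hab : latE a = b + b := by rw [hb, ← add_smul]; norm_num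
    have e1 : latE k + latE a = y + b := by rw [hab, hy]; abel
    have e2 : latE k = y - b := by rw [hy]; abel
    have e1' : latE k' + latE a = y' + b := by rw [hab, hy']; abel
    have e2' : latE k' = y' - b := by rw [hy']; abel
    have hyn : ‖y‖ ≤ K + A / 2 := by rw [hy, ← hbA]; exact (norm_add_le _ _).trans (by linarith)
    have hyn' : ‖y'‖ ≤ K + A / 2 := by
      rw [hy', ← hbA]; exact (norm_add_le _ _).trans (by linarith)
    have hly : ‖l • y‖ ≤ 2 * K + A := by
      rw [norm_smul, Real.norm_of_nonneg (by linarith)]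
      nlinarith [norm_nonneg y]
    have n1 : ‖l • y + b‖ ≤ R := (norm_add_le _ _).trans (by linarith)
    have n2 : ‖l • y - b‖ ≤ R := (norm_sub_le _ _).trans (by linarith)
    have n3 : ‖y' + b‖ ≤ R := (norm_add_le _ _).trans (by linarith)
    have n4 : ‖y' - b‖ ≤ R := (norm_sub_le _ _).trans (by linarith)
    have g := disp_dilation_growth hα₁ hα₂ (by linarith) n1 n2
    have l1 := disp_lipschitz hα₁ n1 n3
    have l2 := disp_lipschitz hα₁ n2 n4
    rw [add_sub_add_right_eq_sub] at l1
    rw [sub_sub_sub_cancel_right] at l2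
    have l3 : lip α R * ‖l • y - y'‖ ≤ lip α R * 2 :=
      mul_le_mul_of_nonneg_left hle' (by linarith)
    have g2 : cvx α R * η * (Y / 4) ^ 2 ≤ cvx α R * (l ^ 2 - 1) * ‖y‖ ^ 2 := by
      have := cvx_nonneg hα₁ R
      have : 0 ≤ l ^ 2 - 1 := hη0.le.trans hlsq
      gcongr
    rw [e1, e2, abs_le] at hkw
    rw [e1', e2', abs_le] at hkw'
    rw [abs_le] at l1 l2
    linarith [hkw.1, hkw.2, hkw'.1, hkw'.2, l1.1, l1.2, l2.1, l2.2]

/-- Counting lattice points in a slab of the sum phase. -/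
lemma card_sum_phase {α K ζ : ℝ} (hα₁ : 1 < α) (hα₂ : α ≤ 2) (hK : 1 ≤ K)
    {a : Fin 3 → ℤ} {S : Finset (Fin 3 → ℤ)}
    (hS : ∀ k ∈ S, ‖latE k‖ ≤ K ∧
      |disp α (latE k + latE a) + disp α (latE k) - ζ| ≤ 3 / 2) :
    (S.card : ℝ) ≤ 120000000 / (α - 1) * K ^ 2 := by
  classical
  have hα' : 0 < α - 1 := by linarith
  have hA0 : 0 ≤ ‖latE a‖ := norm_nonneg _
  have hbA : ‖(1 / 2 : ℝ) • latE a‖ = ‖latE a‖ / 2 := by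
    rw [norm_smul, Real.norm_of_nonneg (by norm_num)]; ring
  rcases le_total (4 * K) ‖latE a‖ with hA | hA
  · have h := card_sum_phase_shell (Y := ‖latE a‖) hα₁ hα₂ hK (by linarith) hS ?_
    · refine h.trans ?_
      rw [min_eq_left (by linarith)]
      have h1 : (K + ‖latE a‖) / ‖latE a‖ ≤ 2 := by
        rw [div_le_iff₀ (by linarith)]; linarith
      calc _ ≤ 2000000 / (α - 1) * K ^ 2 * 2 := by gcongr
        _ = 4000000 / (α - 1) * K ^ 2 := by ring
        _ ≤ _ := by gcongr; norm_num
    · intro k hk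
      have h1 := (hS k hk).1
      have h2 := norm_add_le (latE k) ((1 / 2 : ℝ) • latE a)
      have h3 := norm_sub_le (latE k + (1 / 2 : ℝ) • latE a) (latE k)
      rw [add_sub_cancel_left] at h3
      constructor <;> linarith
  · have key : ∀ j : ℕ,
        ((S.filter fun k => ‖latE k + (1 / 2 : ℝ) • latE a‖ ≤ 2 ^ j).card : ℝ) ≤
          20000000 / (α - 1) * K * 2 ^ j := by
      intro j
      induction j with
      | zero =>
        have h := card_le_of_norm_sub_le (c := -((1 / 2 : ℝ) • latE a)) (r := 1) le_rfl
          (S := S.filter fun k => ‖latE k + (1 / 2 : ℝ) • latE a‖ ≤ 2 ^ 0) (by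
            intro k hk
            rw [sub_neg_eq_add]
            simpa using (Finset.mem_filter.1 hk).2)
        refine h.trans ?_
        have h1 : (20000000 : ℝ) / 1 ≤ 20000000 / (α - 1) := by gcongr; linarith
        nlinarith
      | succ j ih =>
        set T := S.filter fun k => ‖latE k + (1 / 2 : ℝ) • latE a‖ ≤ 2 ^ (j + 1) ∧
          2 ^ j < ‖latE k + (1 / 2 : ℝ) • latE a‖ with hT
        have hY : (1 : ℝ) ≤ 2 ^ (j + 1) := one_le_pow₀ (by norm_num)
        have hsub : (S.filter fun k => ‖latE k + (1 / 2 : ℝ) • latE a‖ ≤ 2 ^ (j + 1)) ⊆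
            (S.filter fun k => ‖latE k + (1 / 2 : ℝ) • latE a‖ ≤ 2 ^ j) ∪ T := by
          intro k hk
          rw [Finset.mem_filter] at hk
          rw [Finset.mem_union, hT, Finset.mem_filter, Finset.mem_filter]
          rcases le_or_gt ‖latE k + (1 / 2 : ℝ) • latE a‖ (2 ^ j) with h | h
          · exact Or.inl ⟨hk.1, h⟩
          · exact Or.inr ⟨hk.1, hk.2, h⟩
        have hcard := (Finset.card_le_card hsub).trans (Finset.card_union_le _ _)
        have hcard' : ((S.filter fun k =>
            ‖latE k + (1 / 2 : ℝ) • latE a‖ ≤ 2 ^ (j + 1)).card : ℝ) ≤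
            (S.filter fun k => ‖latE k + (1 / 2 : ℝ) • latE a‖ ≤ 2 ^ j).card + T.card := by
          exact_mod_cast hcard
        have hTc := card_sum_phase_shell (Y := 2 ^ (j + 1)) (ζ := ζ) hα₁ hα₂ hK hY (a := a)
          (S := T) (fun k hk => hS k (Finset.mem_filter.1 hk).1) (fun k hk => by
            have h := (Finset.mem_filter.1 hk).2
            refine ⟨?_, h.1⟩
            have h2 := h.2
            have : (0 : ℝ) < 2 ^ j := by positivity
            rw [pow_succ]
            linarith)
        have hT2 : (T.card : ℝ) ≤ 10000000 / (α - 1) * K * 2 ^ (j + 1) := by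
          refine hTc.trans ?_
          have hm : min K ((2 : ℝ) ^ (j + 1)) ≤ 2 ^ (j + 1) := min_le_right _ _
          have hm0 : 0 ≤ min K ((2 : ℝ) ^ (j + 1)) := le_min (by linarith) (by linarith)
          calc _ ≤ 2000000 / (α - 1) * (2 ^ (j + 1)) ^ 2 * ((5 * K) / 2 ^ (j + 1)) := by
                gcongr; linarith
            _ = _ := by field_simp; ring
        have e : (20000000 : ℝ) / (α - 1) * K * 2 ^ (j + 1) =
          20000000 / (α - 1) * K * 2 ^ j + 10000000 / (α - 1) * K * 2 ^ (j + 1) := by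
          rw [pow_succ]; ring
        linarith
    obtain ⟨j, hj1, hj2⟩ := exists_nat_pow_near (by linarith : 1 ≤ 3 * K) one_lt_two
    have hall : (S.filter fun k => ‖latE k + (1 / 2 : ℝ) • latE a‖ ≤ 2 ^ (j + 1)) = S := by
      rw [Finset.filter_eq_self]
      intro k hk
      have h2 := norm_add_le (latE k) ((1 / 2 : ℝ) • latE a)
      linarith [(hS k hk).1]
    have h := key (j + 1)
    rw [hall] at h
    calc (S.card : ℝ) ≤ 20000000 / (α - 1) * K * (2 * 2 ^ j) := by rwa [pow_succ, mul_comm _ 2] at h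
      _ ≤ 20000000 / (α - 1) * K * (2 * (3 * K)) := by gcongr
      _ = _ := by ring

/-- The basic counting estimate for a two-term phase. -/
lemma exists_card_phase_le {α : ℝ} (hα₁ : 1 < α) (hα₂ : α ≤ 2) :
    ∃ C : ℝ, 0 < C ∧ ∀ (K : ℝ), 1 ≤ K → ∀ (a : Fin 3 → ℤ) (ε₁ ε₂ ζ : ℝ),
      IsSign ε₁ → IsSign ε₂ → ∀ S : Finset (Fin 3 → ℤ),
      (∀ k ∈ S, ‖latE k‖ ≤ K ∧ |ε₁ * jbb α (k + a) + ε₂ * jbb α k - ζ| ≤ 1) →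
      (S.card : ℝ) ≤ C * (K ^ 2 + K ^ 3 / jb a) := by
  have hα' : 0 < α - 1 := by linarith
  refine ⟨120000000 / (α - 1), by positivity, ?_⟩
  intro K hK a ε₁ ε₂ ζ h₁ h₂ S hS
  have hα1 : (120000000 : ℝ) / 1 ≤ 120000000 / (α - 1) := by gcongr; linarith
  have hjb := one_le_jb a
  have hpos : 0 ≤ K ^ 3 / jb a := by positivity
  have happ : ∀ k, |jbb α (k + a) - disp α (latE k + latE a)| ≤ 1 / 4 := fun k => by
    rw [← latE_add]; exact abs_jbb_sub_disp α hα₁ (k + a)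
  have happ' : ∀ k, |jbb α k - disp α (latE k)| ≤ 1 / 4 := abs_jbb_sub_disp α hα₁
  have plus : ∀ ζ : ℝ, (∀ k ∈ S, ‖latE k‖ ≤ K ∧ |jbb α (k + a) + jbb α k - ζ| ≤ 1) →
      (S.card : ℝ) ≤ 120000000 / (α - 1) * (K ^ 2 + K ^ 3 / jb a) := by
    intro ζ hS
    refine (card_sum_phase (a := a) (ζ := ζ) hα₁ hα₂ hK fun k hk => ⟨(hS k hk).1, ?_⟩).trans ?_
    · have h1 := abs_le.1 (happ k)
      have h2 := abs_le.1 (happ' k)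
      have h3 := abs_le.1 (hS k hk).2
      rw [abs_le]; constructor <;> linarith
    · gcongr; linarith
  have minus : ∀ ζ : ℝ, (∀ k ∈ S, ‖latE k‖ ≤ K ∧ |jbb α (k + a) - jbb α k - ζ| ≤ 1) →
      (S.card : ℝ) ≤ 120000000 / (α - 1) * (K ^ 2 + K ^ 3 / jb a) := by
    intro ζ hS
    by_cases ha : a = 0
    · have h := card_le_of_norm_sub_le (c := 0) (r := K) hK (S := S) (by
        intro k hk; rw [sub_zero]; exact (hS k hk).1)
      have hj : jb a = 1 := by rw [ha, jb]; simp
      rw [hj]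
      have : 0 ≤ K ^ 2 := by positivity
      have : 0 ≤ K ^ 3 := by positivity
      nlinarith
    · have hA1 : 1 ≤ ‖latE a‖ := by
        obtain ⟨i, hi⟩ := Function.ne_iff.1 ha
        refine le_trans ?_ (abs_apply_le_norm (latE a) i)
        rw [latE_apply]
        rw [← Int.cast_abs]
        exact_mod_cast Int.one_le_abs hi
      have h := card_difference_phase (a := a) (ζ := ζ) hα₁ hα₂ hK (by linarith)
        (S := S) fun k hk => ⟨(hS k hk).1, by
          have h1 := abs_le.1 (happ k)
          have h2 := abs_le.1 (happ' k)
          have h3 := abs_le.1 (hS k hk).2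
          rw [abs_le]; constructor <;> linarith⟩
      refine h.trans ?_
      have h1 : (K + ‖latE a‖ + 1) / ‖latE a‖ ≤ 2 + 2 * (K / jb a) := by
        have h2 : (K + ‖latE a‖ + 1) / ‖latE a‖ = K / ‖latE a‖ + 1 + 1 / ‖latE a‖ := by
          field_simp
        have h3 : 1 / ‖latE a‖ ≤ 1 := by rw [div_le_one (by linarith)]; exact hA1
        have h4 : K / ‖latE a‖ ≤ K / (jb a / 2) := by
          gcongr; linarith [jb_le a]
        have h5 : K / (jb a / 2) = 2 * (K / jb a) := by field_simp
        linarith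
      calc _ ≤ 150000 / (α - 1) * K ^ 2 * (2 + 2 * (K / jb a)) := by gcongr
        _ = 300000 / (α - 1) * (K ^ 2 + K ^ 3 / jb a) := by ring
        _ ≤ _ := by gcongr; norm_num
  rcases h₁ with rfl | rfl <;> rcases h₂ with rfl | rfl
  · exact plus ζ fun k hk => by simpa using hS k hk
  · exact minus ζ fun k hk => by simpa [sub_eq_add_neg] using hS k hk
  · refine minus (-ζ) fun k hk => ⟨(hS k hk).1, ?_⟩
    rw [← abs_neg]
    convert (hS k hk).2 using 2; ring
  · refine plus (-ζ) fun k hk => ⟨(hS k hk).1, ?_⟩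
    rw [← abs_neg]
    convert (hS k hk).2 using 2; ring

lemma ind_nonneg (p : Prop) : 0 ≤ ind p := by
  unfold ind; split_ifs <;> norm_num

open Classical in
lemma sum_mul_ind {X : Type*} (B : Finset X) (f : X → ℝ) (p : X → Prop) :
    ∑ x ∈ B, f x * ind (p x) = ∑ x ∈ B.filter p, f x := by
  rw [Finset.sum_filter]
  refine Finset.sum_congr rfl fun x _ => ?_
  unfold ind; split_ifs <;> simp

/-- Dyadic summation of inverse powers of a weight with controlled sublevel sets. -/
lemma sum_inv_pow_le {X : Type*} {B : Finset X} {w : X → ℝ} (hw : ∀ x, 1 ≤ w x) {β i : ℕ} {D : ℝ}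
    (hB : (B.card : ℝ) ≤ D * (2 ^ i) ^ β)
    (hj : ∀ j < i, ∀ S ⊆ B, (∀ x ∈ S, w x < 2 ^ (j + 1)) → (S.card : ℝ) ≤ D * (2 ^ j) ^ β) :
    ∑ x ∈ B, (w x ^ β)⁻¹ ≤ (i + 1) * D := by
  classical
  have hpt : ∀ x ∈ B, (w x ^ β)⁻¹ ≤ (((2 : ℝ) ^ i) ^ β)⁻¹ +
      ∑ j ∈ Finset.range i, (((2 : ℝ) ^ j) ^ β)⁻¹ * ind (w x < 2 ^ (j + 1)) := by
    intro x _
    have hnn : ∀ j ∈ Finset.range i,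
        0 ≤ (((2 : ℝ) ^ j) ^ β)⁻¹ * ind (w x < 2 ^ (j + 1)) := fun j _ =>
      mul_nonneg (by positivity) (ind_nonneg _)
    rcases le_or_gt (2 ^ i) (w x) with h | h
    · have h1 : (w x ^ β)⁻¹ ≤ (((2 : ℝ) ^ i) ^ β)⁻¹ := by gcongr
      linarith [Finset.sum_nonneg hnn]
    · obtain ⟨j, hj1, hj2⟩ := exists_nat_pow_near (hw x) one_lt_two
      have hji : j < i := (pow_lt_pow_iff_right₀ (one_lt_two (α := ℝ))).1 (hj1.trans_lt h)
      have h1 := Finset.single_le_sum hnn (Finset.mem_range.2 hji)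
      have h2 : ind (w x < 2 ^ (j + 1)) = 1 := by rw [ind, if_pos hj2]
      rw [h2, mul_one] at h1
      have h3 : (w x ^ β)⁻¹ ≤ (((2 : ℝ) ^ j) ^ β)⁻¹ := by gcongr
      have h4 : (0 : ℝ) ≤ (((2 : ℝ) ^ i) ^ β)⁻¹ := by positivity
      linarith
  refine (Finset.sum_le_sum hpt).trans ?_
  rw [Finset.sum_add_distrib, Finset.sum_const, nsmul_eq_mul, Finset.sum_comm]
  have h1 : (B.card : ℝ) * (((2 : ℝ) ^ i) ^ β)⁻¹ ≤ D := by
    rw [← div_eq_mul_inv, div_le_iff₀ (by positivity)]; exact hB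
  have h2 : ∀ j ∈ Finset.range i,
      ∑ x ∈ B, (((2 : ℝ) ^ j) ^ β)⁻¹ * ind (w x < 2 ^ (j + 1)) ≤ D := by
    intro j hjm
    rw [sum_mul_ind, Finset.sum_const, nsmul_eq_mul, ← div_eq_mul_inv,
      div_le_iff₀ (by positivity)]
    exact hj j (Finset.mem_range.1 hjm) _ (Finset.filter_subset _ _)
      fun x hx => (Finset.mem_filter.1 hx).2
  have h3 := Finset.sum_le_sum h2
  rw [Finset.sum_const, Finset.card_range, nsmul_eq_mul] at h3
  linarith

lemma pow_mul_pow_le_of_le {p q : ℝ} (hp : 0 ≤ p) (hpq : p ≤ q) {β γ : ℕ} (h : β ≤ γ) :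
    p ^ γ * q ^ β ≤ p ^ β * q ^ γ := by
  obtain ⟨d, rfl⟩ := Nat.exists_eq_add_of_le h
  have h1 : p ^ d ≤ q ^ d := by gcongr
  have h2 : 0 ≤ p ^ β * q ^ β := mul_nonneg (by positivity) (pow_nonneg (hp.trans hpq) _)
  rw [pow_add, pow_add]
  nlinarith [mul_le_mul_of_nonneg_left h1 h2]

lemma sum_inv_jb_le {l : ℕ} {B : Finset (Fin 3 → ℤ)} (hB : ∀ k ∈ B, ‖latE k‖ ≤ 2 ^ l)
    (m : Fin 3 → ℤ) :
    ∑ k ∈ B, (jb (m + k))⁻¹ ≤ (l + 1) * (216 * (2 ^ l) ^ 2) := by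
  have h := sum_inv_pow_le (B := B) (w := fun k => jb (m + k)) (fun _ => one_le_jb _)
    (β := 1) (i := l) (D := 216 * (2 ^ l) ^ 2) ?_ ?_
  · simpa using h
  · have h1 := card_le_of_norm_sub_le (c := 0) (r := 2 ^ l) (one_le_pow₀ (by norm_num))
      (S := B) (by simpa using hB)
    have : (0 : ℝ) < (2 ^ l) ^ 3 := by positivity
    calc _ ≤ _ := h1
      _ ≤ 216 * (2 ^ l) ^ 3 := by linarith
      _ = _ := by ring
  · intro j hj S _ hS
    have h1 := card_le_of_norm_sub_le (c := -latE m) (r := 2 ^ (j + 1))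
      (one_le_pow₀ (by norm_num)) (S := S) (by
        intro k hk
        rw [sub_neg_eq_add, add_comm, ← latE_add]
        exact (norm_le_jb _).trans (hS k hk).le)
    have hle : (2 : ℝ) ^ j ≤ 2 ^ l := pow_le_pow_right₀ (by norm_num) hj.le
    calc _ ≤ _ := h1
      _ = 216 * ((2 ^ j) ^ 2 * (2 ^ j)) := by rw [pow_succ]; ring
      _ ≤ 216 * ((2 ^ l) ^ 2 * (2 ^ j)) := by gcongr
      _ = _ := by ring

lemma exists_sum_phase_le {α : ℝ} (hα₁ : 1 < α) (hα₂ : α ≤ 2) :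
    ∃ C : ℝ, 0 < C ∧ ∀ (β : ℕ), β ≤ 2 → ∀ (i : ℕ) (a : Fin 3 → ℤ) (ε₁ ε₂ ζ : ℝ),
      IsSign ε₁ → IsSign ε₂ → ∀ B : Finset (Fin 3 → ℤ), (∀ k ∈ B, ‖latE k‖ ≤ 2 ^ i) →
      ∑ k ∈ B, (jb (k + a) ^ β)⁻¹ * ind (|ε₁ * jbb α (k + a) + ε₂ * jbb α k - ζ| ≤ 1) ≤
        (i + 1) * (C * ((2 ^ i) ^ 2 + (2 ^ i) ^ 3 / jb a) / (2 ^ i) ^ β) := by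
  classical
  obtain ⟨C, hC, hcount⟩ := exists_card_phase_le hα₁ hα₂
  refine ⟨8 * C, by positivity, ?_⟩
  intro β hβ i a ε₁ ε₂ ζ h₁ h₂ B hB
  have hjb : 0 < jb a := by linarith [one_le_jb a]
  rw [sum_mul_ind]
  refine sum_inv_pow_le (w := fun k => jb (k + a)) (fun _ => one_le_jb _) ?_ ?_
  · rw [div_mul_cancel₀ _ (by positivity)]
    refine (hcount (2 ^ i) (one_le_pow₀ (by norm_num)) a ε₁ ε₂ ζ h₁ h₂ _ fun k hk => ?_).trans ?_
    · rw [Finset.mem_filter] at hk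
      exact ⟨hB k hk.1, hk.2⟩
    · have : 0 ≤ C * ((2 ^ i) ^ 2 + (2 ^ i) ^ 3 / jb a) := by positivity
      linarith
  · intro j hj S hS hSj
    have hle : (2 : ℝ) ^ j ≤ 2 ^ i := pow_le_pow_right₀ (by norm_num) hj.le
    have hcard := hcount (2 ^ (j + 1)) (one_le_pow₀ (by norm_num)) (-a) ε₂ ε₁ ζ h₂ h₁
      (S.image fun k => k + a) (by
        intro k' hk'
        obtain ⟨k, hk, rfl⟩ := Finset.mem_image.1 hk'
        refine ⟨(norm_le_jb _).trans (hSj k hk).le, ?_⟩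
        rw [add_neg_cancel_right, add_comm (ε₂ * _)]
        exact (Finset.mem_filter.1 (hS hk)).2)
    rw [Finset.card_image_of_injective _ (add_left_injective a), jb_neg] at hcard
    refine hcard.trans ?_
    rw [div_mul_eq_mul_div, le_div_iff₀ (by positivity), pow_succ (2 : ℝ) j]
    set p := (2 : ℝ) ^ j
    set q := (2 : ℝ) ^ i
    have hp : 0 < p := by positivity
    have h2 := pow_mul_pow_le_of_le hp.le hle hβ
    have h3 := pow_mul_pow_le_of_le hp.le hle (hβ.trans (by norm_num : 2 ≤ 3))
    have h3' : p ^ 3 / jb a * q ^ β ≤ q ^ 3 / jb a * p ^ β := by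
      rw [div_mul_eq_mul_div, div_mul_eq_mul_div]
      exact div_le_div_of_nonneg_right (by linarith) hjb.le
    have h2' : (p * 2) ^ 2 * q ^ β ≤ 8 * (q ^ 2 * p ^ β) := by
      have : 0 ≤ p ^ 2 * q ^ β := by positivity
      nlinarith
    calc C * ((p * 2) ^ 2 + (p * 2) ^ 3 / jb a) * q ^ β
        = C * ((p * 2) ^ 2 * q ^ β + 8 * (p ^ 3 / jb a * q ^ β)) := by ring
      _ ≤ C * (8 * (q ^ 2 * p ^ β) + 8 * (q ^ 3 / jb a * p ^ β)) := by gcongr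
      _ = _ := by ring

/-- The summand of the three-term phase sum: an inverse power of the bracket of the output frequency
restricted to a slab of the phase. -/
def phaseTerm (α : ℝ) (β : ℕ) (ε₀ ε₁ ε₂ ζ : ℝ) (m x y : Fin 3 → ℤ) : ℝ :=
  (jb (m + x + y) ^ β)⁻¹ *
    ind (|ε₀ * jbb α (m + x + y) + ε₁ * jbb α x + ε₂ * jbb α y - ζ| ≤ 1)

lemma phaseTerm_swap (α : ℝ) (β : ℕ) (ε₀ ε₁ ε₂ ζ : ℝ) (m x y : Fin 3 → ℤ) :
    phaseTerm α β ε₀ ε₁ ε₂ ζ m x y = phaseTerm α β ε₀ ε₂ ε₁ ζ m y x := by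
  rw [phaseTerm, phaseTerm, add_right_comm m x y, add_right_comm _ (ε₁ * _)]

lemma exists_sum_phaseTerm_le_of_le {α : ℝ} (hα₁ : 1 < α) (hα₂ : α ≤ 2) :
    ∃ C : ℝ, 0 < C ∧ ∀ (β : ℕ), β ≤ 2 → ∀ (i l : ℕ), l ≤ i → ∀ (m : Fin 3 → ℤ)
      (ε₀ ε₁ ε₂ ζ : ℝ), IsSign ε₀ → IsSign ε₁ → ∀ B B' : Finset (Fin 3 → ℤ),
      (∀ k ∈ B, ‖latE k‖ ≤ 2 ^ i) → (∀ k ∈ B', ‖latE k‖ ≤ 2 ^ l) →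
      ∑ y ∈ B', ∑ x ∈ B, phaseTerm α β ε₀ ε₁ ε₂ ζ m x y ≤
        C * (i + 1) ^ 2 * ((2 ^ i) ^ 3 * (2 ^ l) ^ 2) / (2 ^ i) ^ β := by
  obtain ⟨C, hC, hsum⟩ := exists_sum_phase_le hα₁ hα₂
  refine ⟨243 * C, by positivity, ?_⟩
  intro β hβ i l hli m ε₀ ε₁ ε₂ ζ h₀ h₁ B B' hB hB'
  have h1 : ∀ y ∈ B', ∑ x ∈ B, phaseTerm α β ε₀ ε₁ ε₂ ζ m x y ≤
      (i + 1) * C / (2 ^ i) ^ β * ((2 ^ i) ^ 2 + (2 ^ i) ^ 3 * (jb (m + y))⁻¹) := by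
    intro y _
    have h := hsum β hβ i (m + y) ε₀ ε₁ (ζ - ε₂ * jbb α y) h₀ h₁ B hB
    refine (le_of_eq (Finset.sum_congr rfl fun x _ => ?_)).trans (h.trans_eq (by ring))
    have e : m + x + y = x + (m + y) := by abel
    rw [phaseTerm, e]
    congr 4
    ring
  refine (Finset.sum_le_sum h1).trans ?_
  rw [← Finset.mul_sum, Finset.sum_add_distrib, ← Finset.mul_sum, Finset.sum_const, nsmul_eq_mul]
  have h2 := sum_inv_jb_le hB' m
  have h3 := card_le_of_norm_sub_le (c := 0) (r := 2 ^ l) (one_le_pow₀ (by norm_num))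
      (S := B') (by simpa using hB')
  set q := (2 : ℝ) ^ i
  set r := (2 : ℝ) ^ l
  have hr : 0 < r := by positivity
  have hrq : r ≤ q := pow_le_pow_right₀ (by norm_num) hli
  have hli' : (l : ℝ) ≤ i := by exact_mod_cast hli
  have hi0 : (0 : ℝ) ≤ i := by positivity
  have h4 : (B'.card : ℝ) * q ^ 2 ≤ 27 * (i + 1) * (q ^ 3 * r ^ 2) := by
    calc (B'.card : ℝ) * q ^ 2 ≤ 27 * r ^ 3 * q ^ 2 := by gcongr
      _ = 27 * (r * r ^ 2 * q ^ 2) := by ring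
      _ ≤ 27 * (q * r ^ 2 * q ^ 2) := by gcongr
      _ = 27 * 1 * (q ^ 3 * r ^ 2) := by ring
      _ ≤ _ := by gcongr; linarith
  have h5 : q ^ 3 * ∑ y ∈ B', (jb (m + y))⁻¹ ≤ 216 * (i + 1) * (q ^ 3 * r ^ 2) := by
    calc _ ≤ q ^ 3 * ((l + 1) * (216 * r ^ 2)) := by gcongr
      _ ≤ q ^ 3 * ((i + 1) * (216 * r ^ 2)) := by gcongr
      _ = _ := by ring
  calc _ ≤ (i + 1) * C / q ^ β *
        (27 * (i + 1) * (q ^ 3 * r ^ 2) + 216 * (i + 1) * (q ^ 3 * r ^ 2)) := by gcongr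
    _ = _ := by ring

/-- The weight `N^{-2α}` at `N = 2^i`. -/
def wt (α : ℝ) (i : ℕ) : ℝ := ((2 : ℝ) ^ i) ^ (-(2 * α))

lemma wt_pos (α : ℝ) (i : ℕ) : 0 < wt α i := by unfold wt; positivity

lemma pow_mul_wt (α : ℝ) (i p : ℕ) :
    ((2 : ℝ) ^ i) ^ p * wt α i = ((2 : ℝ) ^ i) ^ (p - 2 * α) := by
  rw [wt, ← Real.rpow_natCast _ p, ← Real.rpow_add (by positivity), sub_eq_add_neg]

lemma exists_sq_le_rpow {δ : ℝ} (hδ : 0 < δ) :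
    ∃ C : ℝ, 0 < C ∧ ∀ i : ℕ, ((i : ℝ) + 1) ^ 2 ≤ C * ((2 : ℝ) ^ i) ^ δ := by
  have hlog : 0 < Real.log 2 := Real.log_pos one_lt_two
  set c := δ / 2 * Real.log 2 with hc
  have hc0 : 0 < c := by positivity
  refine ⟨(1 + 1 / c) ^ 2, by positivity, fun i => ?_⟩
  have h1 : ((2 : ℝ) ^ i) ^ δ = Real.exp (i * c) ^ 2 := by
    rw [← Real.exp_nat_mul, Real.rpow_def_of_pos (by positivity), Real.log_pow, hc]
    congr 1; push_cast; ring
  rw [h1, ← mul_pow]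
  refine pow_le_pow_left₀ (by positivity) ?_ 2
  have h2 := Real.add_one_le_exp (i * c)
  have hi : (0 : ℝ) ≤ i := by positivity
  calc (i : ℝ) + 1 ≤ (1 + 1 / c) * (i * c + 1) := by
        have : (1 + 1 / c) * (i * c + 1) = i + 1 + (i * c + 1 / c) := by field_simp; ring
        rw [this]
        have : 0 ≤ i * c + 1 / c := by positivity
        linarith
    _ ≤ _ := by gcongr

/-- The weighted double sum over a three-term phase slab. -/
lemma exists_sum_phaseTerm_le {α : ℝ} (hα₁ : 1 < α) (hα₂ : α ≤ 2) :
    ∃ C : ℝ, 0 < C ∧ ∀ (β : ℕ), β ≤ 2 → ∀ (i l : ℕ) (m : Fin 3 → ℤ)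
      (ε₀ ε₁ ε₂ ζ : ℝ), IsSign ε₀ → IsSign ε₁ → IsSign ε₂ → ∀ B B' : Finset (Fin 3 → ℤ),
      (∀ k ∈ B, ‖latE k‖ ≤ 2 ^ i) → (∀ k ∈ B', ‖latE k‖ ≤ 2 ^ l) →
      wt α i * wt α l * ∑ x ∈ B, ∑ y ∈ B', phaseTerm α β ε₀ ε₁ ε₂ ζ m x y ≤
        C * ((2 : ℝ) ^ max i l) ^ (2 - β - α) := by
  obtain ⟨C, hC, hsum⟩ := exists_sum_phaseTerm_le_of_le hα₁ hα₂
  obtain ⟨D, hD, hlog⟩ := exists_sq_le_rpow (by linarith : 0 < α - 1)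
  refine ⟨C * D, by positivity, ?_⟩
  intro β hβ
  have key : ∀ (i l : ℕ), l ≤ i → ∀ (m : Fin 3 → ℤ)
      (ε₀ ε₁ ε₂ ζ : ℝ), IsSign ε₀ → IsSign ε₁ → ∀ B B' : Finset (Fin 3 → ℤ),
      (∀ k ∈ B, ‖latE k‖ ≤ 2 ^ i) → (∀ k ∈ B', ‖latE k‖ ≤ 2 ^ l) →
      wt α i * wt α l * ∑ y ∈ B', ∑ x ∈ B, phaseTerm α β ε₀ ε₁ ε₂ ζ m x y ≤
        C * D * ((2 : ℝ) ^ i) ^ (2 - β - α) := by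
    intro i l hli m ε₀ ε₁ ε₂ ζ h₀ h₁ B B' hB hB'
    have h := hsum β hβ i l hli m ε₀ ε₁ ε₂ ζ h₀ h₁ B B' hB hB'
    have hw1 := wt_pos α i
    have hw2 := wt_pos α l
    have e1 := pow_mul_wt α i 3
    have e2 := pow_mul_wt α l 2
    have h6 : ((2 : ℝ) ^ l) ^ ((2 : ℕ) - 2 * α) ≤ 1 :=
      Real.rpow_le_one_of_one_le_of_nonpos (one_le_pow₀ (by norm_num)) (by push_cast; linarith)
    have h7 := hlog i
    have e3 : ((2 : ℝ) ^ i) ^ (α - 1) * ((2 : ℝ) ^ i) ^ ((3 : ℕ) - 2 * α) / ((2 : ℝ) ^ i) ^ β =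
        ((2 : ℝ) ^ i) ^ (2 - β - α) := by
      rw [← Real.rpow_natCast _ β, ← Real.rpow_add (by positivity),
        ← Real.rpow_sub (by positivity)]
      congr 1; push_cast; ring
    set q := (2 : ℝ) ^ i
    set r := (2 : ℝ) ^ l
    have hq : 0 < q := by positivity
    calc _ ≤ wt α i * wt α l * (C * (i + 1) ^ 2 * (q ^ 3 * r ^ 2) / q ^ β) := by gcongr
      _ = C * (i + 1) ^ 2 * ((q ^ 3 * wt α i) * (r ^ 2 * wt α l)) / q ^ β := by ring
      _ ≤ C * (D * q ^ (α - 1)) * (q ^ ((3 : ℕ) - 2 * α) * 1) / q ^ β := by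
        rw [e1, e2]; gcongr
      _ = C * D * (q ^ (α - 1) * q ^ ((3 : ℕ) - 2 * α) / q ^ β) := by ring
      _ = _ := by rw [e3]
  intro i l m ε₀ ε₁ ε₂ ζ h₀ h₁ h₂ B B' hB hB'
  rcases le_total l i with h | h
  · rw [max_eq_left h, Finset.sum_comm]
    exact key i l h m ε₀ ε₁ ε₂ ζ h₀ h₁ B B' hB hB'
  · rw [max_eq_right h, mul_comm (wt α i)]
    simp only [phaseTerm_swap α β ε₀ ε₁ ε₂]
    exact key l i h m ε₀ ε₂ ε₁ ζ h₀ h₂ B' B hB' hB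

lemma card_mul_wt_mul_rpow_le {α : ℝ} (hα₁ : 1 < α) (hα₂ : α ≤ 3 / 2) {r i M : ℕ} (hr : r ≤ i)
    (hM : M ≤ i) {B : Finset (Fin 3 → ℤ)} (hB : ∀ k ∈ B, ‖latE k‖ ≤ 2 ^ r) {β : ℕ} (hβ : β = 2) :
    B.card * (wt α r * ((2 : ℝ) ^ i) ^ (2 - β - α)) ≤ 27 * ((2 : ℝ) ^ M) ^ (-(α - 1)) := by
  have h1 := card_le_of_norm_sub_le (c := 0) (r := 2 ^ r) (one_le_pow₀ (by norm_num))
      (S := B) (by simpa using hB)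
  have hri : (2 : ℝ) ^ r ≤ 2 ^ i := pow_le_pow_right₀ (by norm_num) hr
  have hMi : (2 : ℝ) ^ M ≤ 2 ^ i := pow_le_pow_right₀ (by norm_num) hM
  have h2 : ((2 : ℝ) ^ r) ^ ((3 : ℕ) - 2 * α) ≤ ((2 : ℝ) ^ i) ^ ((3 : ℕ) - 2 * α) :=
    Real.rpow_le_rpow (by positivity) hri (by push_cast; linarith)
  have h3 : ((2 : ℝ) ^ i) ^ (-(α - 1)) ≤ ((2 : ℝ) ^ M) ^ (-(α - 1)) :=
    Real.rpow_le_rpow_of_nonpos (by positivity) hMi (by linarith)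
  have hw := wt_pos α r
  calc _ ≤ 27 * (2 ^ r) ^ 3 * (wt α r * ((2 : ℝ) ^ i) ^ (2 - β - α)) := by gcongr
    _ = 27 * (((2 ^ r) ^ 3 * wt α r) * ((2 : ℝ) ^ i) ^ (2 - β - α)) := by ring
    _ ≤ 27 * (((2 : ℝ) ^ i) ^ ((3 : ℕ) - 2 * α) * ((2 : ℝ) ^ i) ^ (2 - β - α)) := by
      rw [pow_mul_wt]; gcongr
    _ = 27 * ((2 : ℝ) ^ i) ^ (3 - 3 * α) := by
      rw [← Real.rpow_add (by positivity), hβ]; congr 2; push_cast; ring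
    _ ≤ 27 * ((2 : ℝ) ^ i) ^ (-(α - 1)) := by
      gcongr
      · exact one_le_pow₀ (by norm_num)
      · linarith
    _ ≤ _ := by gcongr

/-- The summand of the cubic sum. -/
def cubicTerm (α ε₀ ε₁ ε₂ ε₃ ζ : ℝ) (x y z : Fin 3 → ℤ) : ℝ :=
  (jb (x + y + z) ^ 2)⁻¹ *
    ind (|ε₀ * jbb α (x + y + z) + ε₁ * jbb α x + ε₂ * jbb α y + ε₃ * jbb α z - ζ| ≤ 1)

lemma cubicTerm_nonneg (α ε₀ ε₁ ε₂ ε₃ ζ : ℝ) (x y z : Fin 3 → ℤ) :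
    0 ≤ cubicTerm α ε₀ ε₁ ε₂ ε₃ ζ x y z := by
  have := one_le_jb (x + y + z)
  exact mul_nonneg (by positivity) (ind_nonneg _)

lemma cubicTerm_eq_fix_last (α ε₀ ε₁ ε₂ ε₃ ζ : ℝ) (x y z : Fin 3 → ℤ) :
    cubicTerm α ε₀ ε₁ ε₂ ε₃ ζ x y z = phaseTerm α 2 ε₀ ε₁ ε₂ (ζ - ε₃ * jbb α z) z x y := by
  have e : z + x + y = x + y + z := by abel
  rw [cubicTerm, phaseTerm, e]
  congr 4; ring

lemma cubicTerm_eq_fix_first (α ε₀ ε₁ ε₂ ε₃ ζ : ℝ) (x y z : Fin 3 → ℤ) :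
    cubicTerm α ε₀ ε₁ ε₂ ε₃ ζ x y z = phaseTerm α 2 ε₀ ε₂ ε₃ (ζ - ε₁ * jbb α x) x y z := by
  rw [cubicTerm, phaseTerm]
  congr 4; ring

/-- The cubic counting estimate. -/
lemma exists_sum_cubicTerm_le {α : ℝ} (hα₁ : 1 < α) (hα₂ : α ≤ 3 / 2) :
    ∃ C : ℝ, 0 < C ∧ ∀ (i₁ i₂ i₃ : ℕ) (ε₀ ε₁ ε₂ ε₃ ζ : ℝ),
      IsSign ε₀ → IsSign ε₁ → IsSign ε₂ → IsSign ε₃ → ∀ B₁ B₂ B₃ : Finset (Fin 3 → ℤ),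
      (∀ k ∈ B₁, ‖latE k‖ ≤ 2 ^ i₁) → (∀ k ∈ B₂, ‖latE k‖ ≤ 2 ^ i₂) →
      (∀ k ∈ B₃, ‖latE k‖ ≤ 2 ^ i₃) →
      wt α i₁ * wt α i₂ * wt α i₃ *
          ∑ x ∈ B₁, ∑ y ∈ B₂, ∑ z ∈ B₃, cubicTerm α ε₀ ε₁ ε₂ ε₃ ζ x y z ≤
        C * ((2 : ℝ) ^ max (max i₁ i₂) i₃) ^ (-(α - 1)) := by
  obtain ⟨C, hC, hsum⟩ := exists_sum_phaseTerm_le hα₁ (by linarith : α ≤ 2)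
  refine ⟨27 * C, by positivity, ?_⟩
  intro i₁ i₂ i₃ ε₀ ε₁ ε₂ ε₃ ζ h₀ h₁ h₂ h₃ B₁ B₂ B₃ hB₁ hB₂ hB₃
  rcases le_total i₃ (max i₁ i₂) with h | h
  · have e : ∑ x ∈ B₁, ∑ y ∈ B₂, ∑ z ∈ B₃, cubicTerm α ε₀ ε₁ ε₂ ε₃ ζ x y z =
        ∑ z ∈ B₃, ∑ x ∈ B₁, ∑ y ∈ B₂, cubicTerm α ε₀ ε₁ ε₂ ε₃ ζ x y z := by
      rw [Finset.sum_comm]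
      refine (Finset.sum_congr rfl fun y _ => Finset.sum_comm).trans ?_
      rw [Finset.sum_comm]
      exact Finset.sum_congr rfl fun z _ => Finset.sum_comm
    have hb : ∀ z ∈ B₃, wt α i₁ * wt α i₂ *
        ∑ x ∈ B₁, ∑ y ∈ B₂, cubicTerm α ε₀ ε₁ ε₂ ε₃ ζ x y z ≤
          C * ((2 : ℝ) ^ max i₁ i₂) ^ (2 - (2 : ℕ) - α) := by
      intro z _
      simp only [cubicTerm_eq_fix_last]
      exact hsum 2 le_rfl i₁ i₂ z ε₀ ε₁ ε₂ _ h₀ h₁ h₂ B₁ B₂ hB₁ hB₂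
    have hb' := Finset.sum_le_sum hb
    rw [← Finset.mul_sum, Finset.sum_const, nsmul_eq_mul] at hb'
    have hw := wt_pos α i₃
    have hc := card_mul_wt_mul_rpow_le hα₁ hα₂ h (max_le le_rfl h) hB₃ rfl
    rw [e]
    calc _ = wt α i₃ * (wt α i₁ * wt α i₂ *
          ∑ z ∈ B₃, ∑ x ∈ B₁, ∑ y ∈ B₂, cubicTerm α ε₀ ε₁ ε₂ ε₃ ζ x y z) := by ring
      _ ≤ wt α i₃ * (B₃.card * (C * ((2 : ℝ) ^ max i₁ i₂) ^ (2 - (2 : ℕ) - α))) := by gcongr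
      _ = C * (B₃.card * (wt α i₃ * ((2 : ℝ) ^ max i₁ i₂) ^ (2 - (2 : ℕ) - α))) := by ring
      _ ≤ C * (27 * ((2 : ℝ) ^ max (max i₁ i₂) i₃) ^ (-(α - 1))) := by gcongr
      _ = _ := by ring
  · have hb : ∀ x ∈ B₁, wt α i₂ * wt α i₃ *
        ∑ y ∈ B₂, ∑ z ∈ B₃, cubicTerm α ε₀ ε₁ ε₂ ε₃ ζ x y z ≤
          C * ((2 : ℝ) ^ max i₂ i₃) ^ (2 - (2 : ℕ) - α) := by
      intro x _
      simp only [cubicTerm_eq_fix_first]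
      exact hsum 2 le_rfl i₂ i₃ x ε₀ ε₂ ε₃ _ h₀ h₂ h₃ B₂ B₃ hB₂ hB₃
    have hb' := Finset.sum_le_sum hb
    rw [← Finset.mul_sum, Finset.sum_const, nsmul_eq_mul] at hb'
    have hw := wt_pos α i₁
    have h13 : i₁ ≤ max i₂ i₃ := ((le_max_left _ _).trans h).trans (le_max_right _ _)
    have hM : max (max i₁ i₂) i₃ ≤ max i₂ i₃ :=
      max_le (h.trans (le_max_right _ _)) (le_max_right _ _)
    have hc := card_mul_wt_mul_rpow_le hα₁ hα₂ h13 hM hB₁ rfl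
    calc _ = wt α i₁ * (wt α i₂ * wt α i₃ *
          ∑ x ∈ B₁, ∑ y ∈ B₂, ∑ z ∈ B₃, cubicTerm α ε₀ ε₁ ε₂ ε₃ ζ x y z) := by ring
      _ ≤ wt α i₁ * (B₁.card * (C * ((2 : ℝ) ^ max i₂ i₃) ^ (2 - (2 : ℕ) - α))) := by gcongr
      _ = C * (B₁.card * (wt α i₁ * ((2 : ℝ) ^ max i₂ i₃) ^ (2 - (2 : ℕ) - α))) := by ring
      _ ≤ C * (27 * ((2 : ℝ) ^ max (max i₁ i₂) i₃) ^ (-(α - 1))) := by gcongr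
      _ = _ := by ring

lemma sum_piFinset_five {X : Type*} [DecidableEq X] (B : Fin 5 → Finset X)
    (f : X → X → X → X → X → ℝ) :
    ∑ n ∈ Fintype.piFinset B, f (n 0) (n 1) (n 2) (n 3) (n 4) =
      ∑ x ∈ B 0, ∑ y ∈ B 1, ∑ z ∈ B 2, ∑ u ∈ B 3, ∑ v ∈ B 4, f x y z u v := by
  simp only [← Finset.sum_product']
  refine Finset.sum_nbij' (fun n => (n 0, n 1, n 2, n 3, n 4))
    (fun p => ![p.1, p.2.1, p.2.2.1, p.2.2.2.1, p.2.2.2.2]) ?_ ?_ ?_ ?_ ?_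
  · intro n hn
    rw [Fintype.mem_piFinset] at hn
    simp [hn]
  · rintro ⟨x, y, z, u, v⟩ hp
    simp only [Finset.mem_product] at hp
    rw [Fintype.mem_piFinset]
    intro j
    fin_cases j <;> simp [hp]
  · intro n _
    funext j
    fin_cases j <;> rfl
  · rintro ⟨x, y, z, u, v⟩ _
    rfl
  · intro n _
    rfl

lemma jbb_rpow_neg_two_le {α : ℝ} (hα : 1 < α) (n : Fin 3 → ℤ) :
    jbb α n ^ (-2 : ℝ) ≤ 4 / 3 * jb n ^ (-(2 * α)) := by
  have hj := one_le_jb n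
  have h0 : 0 < jb n ^ (2 * α) := by positivity
  have h := jbb_sq_ge α hα n
  have hjbb : 0 ≤ jbb α n := Real.sqrt_nonneg _
  rw [Real.rpow_neg hjbb, Real.rpow_neg (by linarith), Real.rpow_two]
  calc (jbb α n ^ 2)⁻¹ ≤ (3 / 4 * jb n ^ (2 * α))⁻¹ := by gcongr
    _ = _ := by rw [mul_inv]; norm_num

lemma jbb_rpow_neg_two_nonneg (α : ℝ) (n : Fin 3 → ℤ) : 0 ≤ jbb α n ^ (-2 : ℝ) :=
  Real.rpow_nonneg (Real.sqrt_nonneg _) _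

lemma norm_latE_le_of_simFreq {i : ℕ} {n : Fin 3 → ℤ} (h : SimFreq (2 ^ i) n) :
    ‖latE n‖ ≤ 2 ^ i := by
  rw [← znorm_eq]
  rcases h with h | h
  · exact h.2.2
  · exact h.2.trans (one_le_pow₀ (by norm_num))

lemma ind_simFreq_mul_jbb_le {α : ℝ} (hα₁ : 1 < α) (hα₂ : α ≤ 3 / 2) (i : ℕ) (n : Fin 3 → ℤ) :
    ind (SimFreq (2 ^ i) n) * jbb α n ^ (-2 : ℝ) ≤ 16 * wt α i := by
  have hw := wt_pos α i
  by_cases h : SimFreq (2 ^ i) n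
  · rw [ind, if_pos h, one_mul]
    have hjb : (2 : ℝ) ^ i / 2 ≤ jb n := by
      rcases h with h | h
      · rw [znorm_eq] at h
        linarith [norm_le_jb n, h.2.1]
      · linarith [one_le_jb n, h.1]
    have h1 : jb n ^ (-(2 * α)) ≤ ((2 : ℝ) ^ i / 2) ^ (-(2 * α)) :=
      Real.rpow_le_rpow_of_nonpos (by positivity) hjb (by linarith)
    have h2 : ((2 : ℝ) ^ i / 2) ^ (-(2 * α)) = (2 : ℝ) ^ (2 * α) * wt α i := by
      rw [Real.div_rpow (by positivity) (by norm_num), wt, Real.rpow_neg (by norm_num : (0:ℝ) ≤ 2),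
        div_inv_eq_mul, mul_comm]
    have h3 : (2 : ℝ) ^ (2 * α) ≤ 8 := by
      calc (2 : ℝ) ^ (2 * α) ≤ (2 : ℝ) ^ (3 : ℝ) := by
            gcongr
            · norm_num
            · linarith
        _ = 8 := by norm_num
    have h4 := jbb_rpow_neg_two_le hα₁ n
    nlinarith
  · rw [ind, if_neg h, zero_mul]; positivity

/-- **Quintic counting estimate** (Lemma 3.7): for `1 < α ≤ 3/2` and `s ≤ α − 1/2`
there exist `θ > 0` and `C > 0`, depending only on `α` and `s` (uniform in the choice
of signs), such that for all dyadic `N₁,…,N₅ ≥ 1` and all `ζ, ζ' ∈ ℝ`,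
`Σ_{n₁,…,n₅} (Π_j 1_{|n_j|∼N_j}) ⟨n₁₂₃₄₅⟩^{2(s−α)} ⟪n₁₂₃⟫⁻² (Π_j ⟪n_j⟫⁻²)
  1_{|κ₂−ζ|≤1} (1_{|κ₃−ζ'|≤1} + 1_{|κ₄−ζ'|≤1}) ≤ C · N_max^{−θ}`. -/
theorem quintic_counting (α s : ℝ) (hα₁ : 1 < α) (hα₂ : α ≤ 3 / 2)
    (hs : s ≤ α - 1 / 2) :
    ∃ θ C : ℝ, 0 < θ ∧ 0 < C ∧
      ∀ ε123 ε12345 : ℝ, IsSign ε123 → IsSign ε12345 →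
        ∀ ε : Fin 5 → ℝ, (∀ j, IsSign (ε j)) →
          ∀ Nv : Fin 5 → ℝ, (∀ j, IsDyadic (Nv j)) → ∀ ζ ζ' : ℝ,
            (∑' n : Fin 5 → Fin 3 → ℤ,
                (∏ j, ind (SimFreq (Nv j) (n j))) *
                  jb (∑ j, n j) ^ (2 * (s - α)) *
                  jbb α (n 0 + n 1 + n 2) ^ (-2 : ℝ) *
                  (∏ j, jbb α (n j) ^ (-2 : ℝ)) *
                  ind (|ε123 * jbb α (n 0 + n 1 + n 2) + ε 0 * jbb α (n 0) +
                        ε 1 * jbb α (n 1) + ε 2 * jbb α (n 2) - ζ| ≤ 1) *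
                  (ind (|ε12345 * jbb α (∑ j, n j) + ε123 * jbb α (n 0 + n 1 + n 2) +
                          ε 3 * jbb α (n 3) + ε 4 * jbb α (n 4) - ζ'| ≤ 1) +
                    ind (|ε12345 * jbb α (∑ j, n j) +
                          (∑ j, ε j * jbb α (n j)) - ζ'| ≤ 1)))
              ≤ C * sSup (Set.range Nv) ^ (-θ) := by
  classical
  obtain ⟨C₃, hC₃, hcubic⟩ := exists_sum_cubicTerm_le hα₁ hα₂
  obtain ⟨C₂, hC₂, hquad⟩ := exists_sum_phaseTerm_le hα₁ (by linarith : α ≤ 2)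
  refine ⟨α - 1, 16 ^ 5 * (4 / 3) * C₃ * (2 * C₂), by linarith, by positivity, ?_⟩
  intro ε123 ε12345 h123 h12345 ε hε Nv hNv ζ ζ'
  choose i hi using hNv
  obtain rfl : Nv = fun j => 2 ^ i j := funext hi
  set B : Fin 5 → Finset (Fin 3 → ℤ) := fun j =>
    (boxAt 0 (2 ^ i j)).filter fun n => ‖latE n‖ ≤ 2 ^ i j with hBdef
  have hB : ∀ j, ∀ k ∈ B j, ‖latE k‖ ≤ 2 ^ i j := fun j k hk => (Finset.mem_filter.1 hk).2
  set P := cubicTerm α ε123 (ε 0) (ε 1) (ε 2) ζ with hP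
  set Q := fun x y z u v : Fin 3 → ℤ =>
    phaseTerm α 1 ε12345 (ε 3) (ε 4) (ζ' - ε123 * jbb α (x + y + z)) (x + y + z) u v +
    phaseTerm α 1 ε12345 (ε 3) (ε 4)
      (ζ' - (ε 0 * jbb α x + ε 1 * jbb α y + ε 2 * jbb α z)) (x + y + z) u v with hQ
  set W := ∏ j, wt α (i j) with hW
  have hW0 : 0 ≤ W := Finset.prod_nonneg fun j _ => (wt_pos α (i j)).le
  rw [tsum_eq_sum (s := Fintype.piFinset B)]
  swap
  · intro n hn
    rw [Fintype.mem_piFinset] at hn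
    push Not at hn
    obtain ⟨j, hj⟩ := hn
    have h0 : ind (SimFreq (2 ^ i j) (n j)) = 0 := by
      rw [ind, if_neg]
      intro hs
      have h1 := norm_latE_le_of_simFreq hs
      exact hj (Finset.mem_filter.2 ⟨mem_boxAt (by rwa [sub_zero]), h1⟩)
    rw [Finset.prod_eq_zero (Finset.mem_univ j) h0]
    simp only [zero_mul]
  have hterm : ∀ n ∈ Fintype.piFinset B,
      (∏ j, ind (SimFreq (2 ^ i j) (n j))) * jb (∑ j, n j) ^ (2 * (s - α)) *
        jbb α (n 0 + n 1 + n 2) ^ (-2 : ℝ) * (∏ j, jbb α (n j) ^ (-2 : ℝ)) *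
        ind (|ε123 * jbb α (n 0 + n 1 + n 2) + ε 0 * jbb α (n 0) +
              ε 1 * jbb α (n 1) + ε 2 * jbb α (n 2) - ζ| ≤ 1) *
        (ind (|ε12345 * jbb α (∑ j, n j) + ε123 * jbb α (n 0 + n 1 + n 2) +
                ε 3 * jbb α (n 3) + ε 4 * jbb α (n 4) - ζ'| ≤ 1) +
          ind (|ε12345 * jbb α (∑ j, n j) + (∑ j, ε j * jbb α (n j)) - ζ'| ≤ 1)) ≤
      16 ^ 5 * (4 / 3) * W *
        (P (n 0) (n 1) (n 2) * Q (n 0) (n 1) (n 2) (n 3) (n 4)) := by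
    intro n _
    set I₂ := ind (|ε123 * jbb α (n 0 + n 1 + n 2) + ε 0 * jbb α (n 0) +
              ε 1 * jbb α (n 1) + ε 2 * jbb α (n 2) - ζ| ≤ 1) with hI₂
    set I₃ := ind (|ε12345 * jbb α (∑ j, n j) + ε123 * jbb α (n 0 + n 1 + n 2) +
                ε 3 * jbb α (n 3) + ε 4 * jbb α (n 4) - ζ'| ≤ 1) with hI₃
    set I₄ := ind (|ε12345 * jbb α (∑ j, n j) + (∑ j, ε j * jbb α (n j)) - ζ'| ≤ 1) with hI₄
    have i₂ : 0 ≤ I₂ := ind_nonneg _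
    have i₃ : 0 ≤ I₃ := ind_nonneg _
    have i₄ : 0 ≤ I₄ := ind_nonneg _
    have j1 := one_le_jb (∑ j, n j)
    have j2 := one_le_jb (n 0 + n 1 + n 2)
    have b1 : jb (∑ j, n j) ^ (2 * (s - α)) ≤ (jb (∑ j, n j) ^ 1)⁻¹ := by
      rw [← Real.rpow_natCast, ← Real.rpow_neg (by linarith)]
      exact Real.rpow_le_rpow_of_exponent_le j1 (by push_cast; linarith)
    have b2 : jbb α (n 0 + n 1 + n 2) ^ (-2 : ℝ) ≤ 4 / 3 * (jb (n 0 + n 1 + n 2) ^ 2)⁻¹ := by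
      refine (jbb_rpow_neg_two_le hα₁ _).trans ?_
      rw [← Real.rpow_natCast, ← Real.rpow_neg (by linarith)]
      gcongr
      push_cast; linarith
    have b3 : (∏ j, ind (SimFreq (2 ^ i j) (n j))) * ∏ j, jbb α (n j) ^ (-2 : ℝ) ≤ 16 ^ 5 * W := by
      rw [← Finset.prod_mul_distrib]
      refine (Finset.prod_le_prod (fun j _ => mul_nonneg (ind_nonneg _)
        (jbb_rpow_neg_two_nonneg α _)) fun j _ =>
          ind_simFreq_mul_jbb_le hα₁ hα₂ (i j) (n j)).trans_eq ?_
      rw [Finset.prod_mul_distrib, hW]; simp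
    have n2 := jbb_rpow_neg_two_nonneg α (n 0 + n 1 + n 2)
    have n3 : 0 ≤ (∏ j, ind (SimFreq (2 ^ i j) (n j))) * ∏ j, jbb α (n j) ^ (-2 : ℝ) :=
      mul_nonneg (Finset.prod_nonneg fun j _ => ind_nonneg _)
        (Finset.prod_nonneg fun j _ => jbb_rpow_neg_two_nonneg α _)
    have e5 : n 0 + n 1 + n 2 + n 3 + n 4 = ∑ j, n j := (Fin.sum_univ_five n).symm
    have eP : P (n 0) (n 1) (n 2) = (jb (n 0 + n 1 + n 2) ^ 2)⁻¹ * I₂ := rfl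
    have eQ : Q (n 0) (n 1) (n 2) (n 3) (n 4) = (jb (∑ j, n j) ^ 1)⁻¹ * (I₃ + I₄) := by
      simp only [hQ, phaseTerm]
      rw [e5, mul_add, hI₃, hI₄, Fin.sum_univ_five (fun j => ε j * jbb α (n j))]
      congr 5 <;> ring
    rw [eP, eQ]
    calc _ = ((∏ j, ind (SimFreq (2 ^ i j) (n j))) * ∏ j, jbb α (n j) ^ (-2 : ℝ)) *
          jb (∑ j, n j) ^ (2 * (s - α)) * jbb α (n 0 + n 1 + n 2) ^ (-2 : ℝ) * I₂ * (I₃ + I₄) := by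
          ring
      _ ≤ (16 ^ 5 * W) * (jb (∑ j, n j) ^ 1)⁻¹ * (4 / 3 * (jb (n 0 + n 1 + n 2) ^ 2)⁻¹) *
          I₂ * (I₃ + I₄) := by gcongr
      _ = _ := by ring
  refine (Finset.sum_le_sum hterm).trans ?_
  rw [← Finset.mul_sum, sum_piFinset_five B fun x y z u v => P x y z * Q x y z u v]
  simp only [← Finset.mul_sum]
  set q₂ := ((2 : ℝ) ^ max (i 3) (i 4)) ^ (-(α - 1)) with hq₂
  set q₃ := ((2 : ℝ) ^ max (max (i 0) (i 1)) (i 2)) ^ (-(α - 1)) with hq₃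
  have hinner : ∀ x y z, wt α (i 3) * wt α (i 4) *
      ∑ u ∈ B 3, ∑ v ∈ B 4, Q x y z u v ≤ 2 * C₂ * q₂ := by
    intro x y z
    have h := fun ξ => hquad 1 (by norm_num) (i 3) (i 4) (x + y + z) ε12345 (ε 3) (ε 4) ξ
      h12345 (hε 3) (hε 4) (B 3) (B 4) (hB 3) (hB 4)
    have e : (2 : ℝ) - (1 : ℕ) - α = -(α - 1) := by push_cast; ring
    rw [e] at h
    simp only [hQ, Finset.sum_add_distrib, mul_add]
    linarith [h (ζ' - ε123 * jbb α (x + y + z)),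
      h (ζ' - (ε 0 * jbb α x + ε 1 * jbb α y + ε 2 * jbb α z))]
  have houter := hcubic (i 0) (i 1) (i 2) ε123 (ε 0) (ε 1) (ε 2) ζ h123 (hε 0) (hε 1) (hε 2)
    (B 0) (B 1) (B 2) (hB 0) (hB 1) (hB 2)
  have hw3 := wt_pos α (i 3)
  have hw4 := wt_pos α (i 4)
  have hw012 : 0 ≤ wt α (i 0) * wt α (i 1) * wt α (i 2) := by
    have := wt_pos α (i 0)
    have := wt_pos α (i 1)
    have := wt_pos α (i 2)
    positivity
  have hsum : W * ∑ x ∈ B 0, ∑ y ∈ B 1, ∑ z ∈ B 2,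
      P x y z * ∑ u ∈ B 3, ∑ v ∈ B 4, Q x y z u v ≤ C₃ * q₃ * (2 * C₂ * q₂) := by
    have hW' : W = wt α (i 0) * wt α (i 1) * wt α (i 2) * (wt α (i 3) * wt α (i 4)) := by
      rw [hW, Fin.prod_univ_five]; ring
    calc _ = wt α (i 0) * wt α (i 1) * wt α (i 2) * ∑ x ∈ B 0, ∑ y ∈ B 1, ∑ z ∈ B 2,
          P x y z * (wt α (i 3) * wt α (i 4) * ∑ u ∈ B 3, ∑ v ∈ B 4, Q x y z u v) := by
          simp only [mul_left_comm (P _ _ _) (wt α (i 3) * wt α (i 4)), ← Finset.mul_sum]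
          rw [hW']; ring
      _ ≤ wt α (i 0) * wt α (i 1) * wt α (i 2) * ∑ x ∈ B 0, ∑ y ∈ B 1, ∑ z ∈ B 2,
          P x y z * (2 * C₂ * q₂) := by
          refine mul_le_mul_of_nonneg_left ?_ hw012
          refine Finset.sum_le_sum fun x _ => Finset.sum_le_sum fun y _ =>
            Finset.sum_le_sum fun z _ => ?_
          exact mul_le_mul_of_nonneg_left (hinner x y z) (cubicTerm_nonneg _ _ _ _ _ _ _ _ _)
      _ = (wt α (i 0) * wt α (i 1) * wt α (i 2) *
          ∑ x ∈ B 0, ∑ y ∈ B 1, ∑ z ∈ B 2, P x y z) * (2 * C₂ * q₂) := by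
          simp only [← Finset.sum_mul]; ring
      _ ≤ _ := mul_le_mul_of_nonneg_right houter (by positivity)
  have hmax : q₃ * q₂ ≤ sSup (Set.range fun j => (2 : ℝ) ^ i j) ^ (-(α - 1)) := by
    obtain ⟨j, hj⟩ := exists_eq_ciSup_of_finite (f := fun j => (2 : ℝ) ^ i j)
    have hj' : sSup (Set.range fun j => (2 : ℝ) ^ i j) = 2 ^ i j := hj.symm
    rw [hj', hq₂, hq₃, ← Real.mul_rpow (by positivity) (by positivity), ← pow_add]
    refine Real.rpow_le_rpow_of_nonpos (by positivity) ?_ (by linarith)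
    refine pow_le_pow_right₀ (by norm_num) ?_
    fin_cases j <;> simp only [Fin.reduceFinMk, Fin.zero_eta, Fin.isValue, Fin.mk_one] <;> omega
  calc _ = 16 ^ 5 * (4 / 3) * (W * ∑ x ∈ B 0, ∑ y ∈ B 1, ∑ z ∈ B 2,
        P x y z * ∑ u ∈ B 3, ∑ v ∈ B 4, Q x y z u v) := by ring
    _ ≤ 16 ^ 5 * (4 / 3) * (C₃ * q₃ * (2 * C₂ * q₂)) := by gcongr
    _ = 16 ^ 5 * (4 / 3) * C₃ * (2 * C₂) * (q₃ * q₂) := by ring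
    _ ≤ _ := by gcongr
end
end
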